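/- Let X ⊂ P^{n+c} be a nondegenerate irreducible projective variety of codimension c and degree d. If a₂(X) = C(c+1,2) + 1 − k for an integer k with 1 ≤ k ≤ c, then d ≤ c + k. -/

import Mathlib

/-!
Common framework: a projective variety `X ⊆ ℙ^N` over a field `k` is represented by its
affine cone `C ⊆ (ι → k)` (with `ι` the index type of homogeneous coordinates,
`Fintype.card ι = N + 1`).  All projective notions (vanishing ideal, `a₂`, Hilbert
function, dimension, degree, depth, base locus of quadrics, irreducible components,
scrolls and divisors on them, sectional genus, maximal sectional regularity) are
defined concretely below.
-/

open MvPolynomial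

noncomputable section

namespace PaperQuadrics

variable (k : Type) [Field k] (ι : Type) [Fintype ι] [DecidableEq ι]

/-- The vanishing ideal of a subset `C` of the affine cone `ι → k`. -/
def vanIdeal (C : Set (ι → k)) : Ideal (MvPolynomial ι k) :=
  ⨅ x ∈ C, RingHom.ker (MvPolynomial.eval x)

/-- The degree-`m` graded piece of an ideal of the polynomial ring. -/
def idealPiece (I : Ideal (MvPolynomial ι k)) (m : ℕ) : Submodule k (MvPolynomial ι k) :=
  Submodule.restrictScalars k I ⊓ homogeneousSubmodule ι k m

/-- The space of quadrics vanishing on `C`, i.e. `H⁰(ℙ^N, I_C(2))`. -/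
def quadrics (C : Set (ι → k)) : Submodule k (MvPolynomial ι k) :=
  idealPiece k ι (vanIdeal k ι C) 2

/-- `a₂(C) = h⁰(ℙ^N, I_C(2))`, the number of linearly independent quadrics through `C`. -/
def a2 (C : Set (ι → k)) : ℕ := Module.finrank k (quadrics k ι C)

/-- The Hilbert function of `R/I` in degree `m`. -/
def idealHilb (I : Ideal (MvPolynomial ι k)) (m : ℕ) : ℕ :=
  Module.finrank k (homogeneousSubmodule ι k m) - Module.finrank k (idealPiece k ι I m)

/-- The Hilbert function of the homogeneous coordinate ring of `C`. -/
def hilb (C : Set (ι → k)) (m : ℕ) : ℕ := idealHilb k ι (vanIdeal k ι C) m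

/-- `C ⊆ ι → k` is the affine cone of an irreducible projective variety:
it is a Zariski-closed cone whose vanishing ideal is prime. -/
structure IsProjVariety (C : Set (ι → k)) : Prop where
  zero_mem : (0 : ι → k) ∈ C
  smul_mem : ∀ x ∈ C, ∀ t : k, t • x ∈ C
  closed : C = {x | ∀ f ∈ vanIdeal k ι C, MvPolynomial.eval x f = 0}
  prime : (vanIdeal k ι C).IsPrime

/-- Nondegenerate: no nonzero linear form vanishes identically on `C`. -/
def Nondeg (C : Set (ι → k)) : Prop :=
  ∀ f ∈ homogeneousSubmodule ι k 1, (∀ x ∈ C, MvPolynomial.eval x f = 0) → f = 0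

/-- The projective variety with cone `C` has dimension `n`
(so the affine cone has Krull dimension `n + 1`). -/
def HasDim (C : Set (ι → k)) (n : ℕ) : Prop :=
  ringKrullDim (MvPolynomial ι k ⧸ vanIdeal k ι C) = (n + 1 : ℕ)

/-- `C` (of projective dimension `n`) has degree `d`:
the Hilbert function satisfies `hF(m) · n! / mⁿ → d`. -/
def HasDegree (C : Set (ι → k)) (n d : ℕ) : Prop :=
  Filter.Tendsto (fun m : ℕ => (hilb k ι C m : ℝ) * (Nat.factorial n : ℝ) / (m : ℝ) ^ n)
    Filter.atTop (nhds (d : ℝ))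

/-- `Q(C)`: the common zero set (base locus) of all quadrics through `C`. -/
def quadZero (C : Set (ι → k)) : Set (ι → k) :=
  {x | ∀ f ∈ quadrics k ι C, MvPolynomial.eval x f = 0}

/-- `fs` is a regular sequence on `R/I`. -/
def IsRegSeqOn (I : Ideal (MvPolynomial ι k)) (fs : List (MvPolynomial ι k)) : Prop :=
  (∀ i : Fin fs.length, ∀ g : MvPolynomial ι k,
      fs.get i * g ∈ I ⊔ Ideal.span {h | ∃ j : Fin fs.length, j < i ∧ fs.get j = h} →
      g ∈ I ⊔ Ideal.span {h | ∃ j : Fin fs.length, j < i ∧ fs.get j = h}) ∧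
  I ⊔ Ideal.span {h | ∃ j : Fin fs.length, fs.get j = h} ≠ ⊤

/-- Arithmetic depth of the homogeneous coordinate ring of `C`: the supremum of lengths of
regular sequences of elements of the irrelevant maximal ideal. -/
def arithDepth (C : Set (ι → k)) : ℕ :=
  sSup {l : ℕ | ∃ fs : List (MvPolynomial ι k), fs.length = l ∧
    (∀ f ∈ fs, MvPolynomial.coeff 0 f = 0) ∧ IsRegSeqOn k ι (vanIdeal k ι C) fs}

/-- `Z` is an irreducible Zariski-closed cone. -/
def IsIrredClosed (Z : Set (ι → k)) : Prop :=
  Z = {x | ∀ f ∈ vanIdeal k ι Z, MvPolynomial.eval x f = 0} ∧ (vanIdeal k ι Z).IsPrime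

/-- `Z` is an irreducible component of `Q`: an irreducible closed subset of `Q`, maximal
among the irreducible closed subsets of `Q`. -/
def IsComponentOf (Z Q : Set (ι → k)) : Prop :=
  IsIrredClosed k ι Z ∧ Z ⊆ Q ∧
    ∀ Z' : Set (ι → k), IsIrredClosed k ι Z' → Z ⊆ Z' → Z' ⊆ Q → Z' = Z

/-- `C` is smooth away from the cone vertex, of codimension `c`: at each nonzero point the
Jacobian of the vanishing ideal has rank `c` (valid criterion in characteristic `0`). -/
def IsSmoothOfCodim (C : Set (ι → k)) (c : ℕ) : Prop :=
  ∀ x ∈ C, x ≠ (0 : ι → k) →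
    Module.finrank k (Submodule.span k
      {v : ι → k | ∃ f ∈ vanIdeal k ι C,
        v = fun i => MvPolynomial.eval x (MvPolynomial.pderiv i f)}) = c

/-- The projective variety with affine cone `C` is a cone (in the projective sense):
there is a vertex point `[v]` such that `C` is stable under the join with `[v]`. -/
def IsConeVariety (C : Set (ι → k)) : Prop :=
  ∃ v ∈ C, v ≠ 0 ∧ ∀ x ∈ C, ∀ s t : k, s • x + t • v ∈ C

/-- `C` (an `n`-dimensional variety of degree `d`) has sectional genus `g`: a general linear
curve section (cut by `n - 1` general hyperplanes) has Hilbert polynomial `d·m + 1 - g`. -/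
def SectionalGenus (n : ℕ) (C : Set (ι → k)) (d g : ℕ) : Prop :=
  ∃ P : MvPolynomial (Fin (n - 1) × ι) k, P ≠ 0 ∧
    ∀ w : Fin (n - 1) → ι → k, MvPolynomial.eval (fun q => w q.1 q.2) P ≠ 0 →
      ∀ᶠ m in Filter.atTop,
        (hilb k ι (C ∩ {x | ∀ j, ∑ i, w j i * x i = 0}) m : ℤ) = d * m + 1 - g

/-- `C` (an `n`-dimensional variety of degree `c + 3`) is a variety of maximal sectional
regularity: there is an `n`-dimensional linear subspace `F(X) = ℙ(L)` such that
`X ∩ F(X)` is (scheme-theoretically) a hypersurface of degree `4` in `F(X) ≅ ℙⁿ`,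
detected by the Hilbert function of the ideal sum. -/
def IsVMSR (n : ℕ) (C : Set (ι → k)) : Prop :=
  ∃ L : Submodule k (ι → k), Module.finrank k L = n + 1 ∧
    ∀ᶠ m in Filter.atTop,
      idealHilb k ι (vanIdeal k ι C ⊔ vanIdeal k ι (L : Set (ι → k))) m =
        Nat.choose (m + n) n - Nat.choose (m - 4 + n) n

end PaperQuadrics

namespace PaperQuadrics

variable {k : Type} [Field k]

/-- The parametrization of the rational normal scroll `S(a₀, …, aₙ)` (so the scroll has
dimension `n + 1`): homogeneous coordinates are indexed by `(i, j)`, `0 ≤ j ≤ aᵢ`,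
and the point of parameters `(s : t) ∈ ℙ¹`, `λ` has coordinates `λᵢ sʲ t^{aᵢ - j}`. -/
def scrollParam (n : ℕ) (a : Fin (n + 1) → ℕ) (s t : k) (lam : Fin (n + 1) → k) :
    ((i : Fin (n + 1)) × Fin (a i + 1)) → k :=
  fun x => lam x.1 * s ^ (x.2 : ℕ) * t ^ (a x.1 - (x.2 : ℕ))

/-- The affine cone of the scroll `S(a₀, …, aₙ) ⊆ ℙ^{n+1+c-1}`, `c = Σ aᵢ`. -/
def scrollCone (n : ℕ) (a : Fin (n + 1) → ℕ) :
    Set (((i : Fin (n + 1)) × Fin (a i + 1)) → k) :=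
  {v | ∃ s t lam, v = scrollParam n a s t lam}

/-- Global sections of `O_Y(A·H + b·F)` on the scroll `Y = S(a₀, …, aₙ)`, realized as
bihomogeneous polynomials in `s, t` (the `ℙ¹`-coordinates) and `T₀, …, Tₙ` (the fiber
coordinates): each monomial has total `T`-degree `A` and `(s,t)`-degree `b + Σ mᵢ aᵢ`. -/
def sectionSpace (k : Type) [Field k] (n : ℕ) (a : Fin (n + 1) → ℕ) (A b : ℤ) :
    Submodule k (MvPolynomial (Fin 2 ⊕ Fin (n + 1)) k) where
  carrier := {F | ∀ m ∈ F.support,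
    ((∑ i, m (Sum.inr i) : ℕ) : ℤ) = A ∧
    ((m (Sum.inl 0) + m (Sum.inl 1) : ℕ) : ℤ)
      = b + ∑ i, (m (Sum.inr i) : ℤ) * (a i : ℤ)}
  add_mem' := by
    intro p q hp hq m hm
    rcases Finset.mem_union.mp (MvPolynomial.support_add hm) with h | h
    · exact hp m h
    · exact hq m h
  zero_mem' := by
    intro m hm
    simp at hm
  smul_mem' := by
    intro c p hp m hm
    exact hp m (MvPolynomial.support_smul hm)

/-- The affine cone of the effective divisor `X ≡ A·H + b·F` on the scroll cut out by a
section `F`: the points of the scroll whose parameters are zeros of `F`. -/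
def divisorCone (n : ℕ) (a : Fin (n + 1) → ℕ)
    (F : MvPolynomial (Fin 2 ⊕ Fin (n + 1)) k) :
    Set (((i : Fin (n + 1)) × Fin (a i + 1)) → k) :=
  {v | ∃ s t lam, v = scrollParam n a s t lam ∧
     MvPolynomial.eval (Sum.elim (fun j : Fin 2 => if j = 0 then s else t) lam) F = 0}

end PaperQuadrics

open PaperQuadrics

section Isoperimetric

variable {F L : Type} [Field F] [Field L] [Algebra F L]

open Module in
theorem finrank_map_mulLeft {a : L} (ha : a ≠ 0) (X : Submodule F L) :
    finrank F (X.map (LinearMap.mulLeft F a)) = finrank F X := by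
  refine (LinearEquiv.finrank_eq (Submodule.equivMapOfInjective (LinearMap.mulLeft F a) ?_ X)).symm
  intro x y h
  simpa [ha] using h

theorem map_mulLeft_mul (a : L) (X V : Submodule F L) :
    X.map (LinearMap.mulLeft F a) * V = (X * V).map (LinearMap.mulLeft F a) := by
  apply le_antisymm
  · rw [Submodule.mul_le]
    rintro _ ⟨x, hx, rfl⟩ v hv
    exact ⟨x * v, Submodule.mul_mem_mul hx hv, by simp [mul_assoc]⟩
  · rw [Submodule.map_le_iff_le_comap, Submodule.mul_le]
    intro x hx v hv
    simp only [Submodule.mem_comap, LinearMap.mulLeft_apply, ← mul_assoc]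
    exact Submodule.mul_mem_mul ⟨x, hx, rfl⟩ hv

open Module in
/-- A linear Cauchy–Davenport inequality in a primitive separable extension. -/
theorem two_mul_finrank_le_finrank_mul_self [FiniteDimensional F L] [Algebra.IsSeparable F L]
    (hE : ∀ E : IntermediateField F L, E = ⊥ ∨ E = ⊤) (V : Submodule F L) (h1 : 1 ∈ V) :
    V * V = ⊤ ∨ 2 * finrank F V ≤ finrank F (V * V : Submodule F L) + 1 := by
  by_cases hVV : V * V = ⊤
  · exact Or.inl hVV
  right
  have hle : ∀ X : Submodule F L, X ≤ X * V := fun X x hx => by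
    simpa using Submodule.mul_mem_mul hx h1
  have hfle : ∀ X : Submodule F L, finrank F X ≤ finrank F (X * V : Submodule F L) :=
    fun X => Submodule.finrank_mono (hle X)
  have hD : ∀ X : Submodule F L, finrank F X ≤ finrank F L := fun X => Submodule.finrank_le X
  have hlt : ∀ X : Submodule F L, X ≠ ⊤ → finrank F X < finrank F L := fun X hX =>
    Submodule.finrank_lt hX
  have hpos : ∀ X : Submodule F L, X ≠ ⊥ → 0 < finrank F X := fun X hX =>
    Nat.pos_of_ne_zero (fun h => hX (Submodule.finrank_eq_zero.mp h))
  let P : Submodule F L → Prop := fun X => X ≠ ⊥ ∧ X * V ≠ ⊤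
  have hV0 : V ≠ ⊥ := fun h => by rw [h] at h1; exact one_ne_zero ((Submodule.mem_bot F).1 h1)
  have hPV : P V := ⟨hV0, hVV⟩
  obtain ⟨A₀, hA₀P, hA₀⟩ := exists_minimalFor_of_wellFoundedLT P
    (fun X => (finrank F (X * V : Submodule F L) - finrank F X) * (finrank F L + 1) +
      finrank F X) ⟨V, hPV⟩
  obtain ⟨κ, hκ⟩ : ∃ κ, finrank F (A₀ * V : Submodule F L) = finrank F A₀ + κ :=
    ⟨_, (Nat.add_sub_cancel' (hfle A₀)).symm⟩
  obtain ⟨r, hr⟩ : ∃ r, finrank F A₀ = r := ⟨_, rfl⟩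
  have hmin : ∀ X, P X → finrank F X + κ ≤ finrank F (X * V : Submodule F L) ∧
      (finrank F (X * V : Submodule F L) ≤ finrank F X + κ → r ≤ finrank F X) := by
    intro X hX
    have h := hA₀ hX
    simp only [hκ, hr, Nat.add_sub_cancel_left] at h
    have hX1 := hD X
    have hX2 := hD A₀
    have hX3 := hfle X
    obtain ⟨e, he⟩ : ∃ e, finrank F (X * V : Submodule F L) = finrank F X + e :=
      ⟨_, (Nat.add_sub_cancel' hX3).symm⟩
    rw [he, Nat.add_sub_cancel_left] at h
    rw [he]
    have hκe : κ ≤ e := by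
      by_contra hlt
      have h1 : e + 1 ≤ κ := by omega
      have h3 : (e + 1) * (finrank F L + 1) ≤ κ * (finrank F L + 1) := Nat.mul_le_mul_right _ h1
      have h2 := h (by nlinarith)
      nlinarith
    refine ⟨by omega, fun h' => ?_⟩
    have : e = κ := by omega
    subst this
    by_contra hc
    have := h (by omega)
    omega
  -- duality
  have hdual : r + (r + κ) ≤ finrank F L := by
    have hnd := traceForm_nondegenerate F L
    set X := (Algebra.traceForm F L).orthogonal (A₀ * V) with hX
    have hfX : finrank F X = finrank F L - (r + κ) := by
      rw [hX, LinearMap.BilinForm.finrank_orthogonal hnd, hκ, hr]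
    have hlt' := hlt _ hA₀P.2
    rw [hκ, hr] at hlt'
    have hXV : X * V ≤ (Algebra.traceForm F L).orthogonal A₀ := by
      rw [Submodule.mul_le]
      intro x hx v hv
      rw [LinearMap.BilinForm.mem_orthogonal_iff] at hx ⊢
      intro a ha
      have := hx (a * v) (Submodule.mul_mem_mul ha hv)
      rw [Algebra.traceForm_apply] at this ⊢
      rw [← this]; congr 1; ring
    have h2 := Submodule.finrank_mono hXV
    rw [LinearMap.BilinForm.finrank_orthogonal hnd, hr] at h2
    have hr0 := hpos _ hA₀P.1
    have hPX : P X := by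
      constructor
      · intro h
        rw [h, finrank_bot] at hfX
        omega
      · intro h
        rw [h, finrank_top] at h2
        omega
    have h3 := (hmin X hPX).2 (by omega)
    omega
  -- two atoms meeting nontrivially coincide
  have hatom : ∀ A B : Submodule F L, P A → P B → finrank F A = r → finrank F B = r →
      finrank F (A * V : Submodule F L) = r + κ → finrank F (B * V : Submodule F L) = r + κ →
      A ⊓ B ≠ ⊥ → A ≤ B := by
    intro A B hA hB hAr hBr hAV hBV hAB
    have e1 := Submodule.finrank_sup_add_finrank_inf_eq A B
    have e2 := Submodule.finrank_sup_add_finrank_inf_eq (A * V) (B * V)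
    have hinf : (A ⊓ B) * V ≤ A * V ⊓ B * V :=
      le_inf (mul_le_mul' inf_le_left le_rfl) (mul_le_mul' inf_le_right le_rfl)
    have h3 := Submodule.finrank_mono hinf
    have hPI : P (A ⊓ B) := ⟨hAB, fun h => hA.2 (top_le_iff.1 (h ▸ (hinf.trans inf_le_left)))⟩
    have h4 := hmin _ hPI
    have h5 := hpos _ hAB
    rw [← Submodule.sup_mul] at e2
    have hPS : P (A ⊔ B) := by
      constructor
      · intro h
        exact hA.1 (le_bot_iff.1 (h ▸ le_sup_left))
      · intro h
        rw [h, finrank_top] at e2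
        omega
    have h6 := hmin _ hPS
    have h7 := h4.2 (by omega)
    have : A ⊓ B = A := Submodule.eq_of_le_of_finrank_le inf_le_left (by omega)
    exact inf_eq_left.1 this
  obtain ⟨a₀, ha₀, ha₀0⟩ := Submodule.exists_mem_ne_zero_of_ne_bot hA₀P.1
  let sc : L → Submodule F L → Submodule F L := fun a X => X.map (LinearMap.mulLeft F a)
  have hPsc : ∀ a : L, a ≠ 0 → ∀ X, P X → P (sc a X) := by
    intro a ha X hX
    constructor
    · intro h
      have := finrank_map_mulLeft ha X
      rw [show X.map (LinearMap.mulLeft F a) = ⊥ from h, finrank_bot] at this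
      exact hX.1 (Submodule.finrank_eq_zero.mp this.symm)
    · intro h
      have h' := finrank_map_mulLeft ha (X * V)
      rw [← map_mulLeft_mul, show X.map (LinearMap.mulLeft F a) * V = ⊤ from h, finrank_top] at h'
      exact (hlt _ hX.2).ne h'.symm
  set A := sc a₀⁻¹ A₀ with hAdef
  have hPA : P A := hPsc _ (inv_ne_zero ha₀0) _ hA₀P
  have hAr : finrank F A = r := by rw [hAdef, finrank_map_mulLeft (inv_ne_zero ha₀0), hr]
  have hAV : finrank F (A * V : Submodule F L) = r + κ := by
    rw [hAdef, map_mulLeft_mul, finrank_map_mulLeft (inv_ne_zero ha₀0), hκ, hr]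
  have h1A : (1 : L) ∈ A := ⟨a₀, ha₀, by simp [ha₀0]⟩
  have hkey : ∀ a ∈ A, a ≠ 0 → sc a⁻¹ A ≤ A ∧ A ≤ sc a⁻¹ A := by
    intro a ha ha0
    have hi := inv_ne_zero ha0
    have h1' : (1 : L) ∈ sc a⁻¹ A := ⟨a, ha, by simp [ha0]⟩
    have p := hPsc _ hi _ hPA
    have f1 : finrank F (sc a⁻¹ A) = r := by rw [finrank_map_mulLeft hi, hAr]
    have f2 : finrank F (sc a⁻¹ A * V : Submodule F L) = r + κ := by
      rw [map_mulLeft_mul, finrank_map_mulLeft hi, hAV]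
    exact ⟨hatom _ _ p hPA f1 hAr f2 hAV (Submodule.ne_bot_iff _ |>.2
        ⟨1, ⟨h1', h1A⟩, one_ne_zero⟩),
      hatom _ _ hPA p hAr f1 hAV f2 (Submodule.ne_bot_iff _ |>.2
        ⟨1, ⟨h1A, h1'⟩, one_ne_zero⟩)⟩
  have hmul : ∀ x y, x ∈ A → y ∈ A → x * y ∈ A := by
    intro x y hx hy
    by_cases hx0 : x = 0
    · simp [hx0]
    obtain ⟨z, hz, hzy⟩ := (hkey x hx hx0).2 hy
    have : x * y = z := by
      rw [← hzy]; simp [hx0]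
    rwa [this]
  have hinv : ∀ x ∈ A.toSubalgebra h1A hmul, x⁻¹ ∈ A.toSubalgebra h1A hmul := by
    intro x hx
    by_cases hx0 : x = 0
    · simp [hx0]
    exact (hkey x hx hx0).1 ⟨1, h1A, by simp⟩
  have hmemE : ∀ x, x ∈ (A.toSubalgebra h1A hmul).toIntermediateField hinv ↔ x ∈ A :=
    fun x => Iff.rfl
  rcases hE ((A.toSubalgebra h1A hmul).toIntermediateField hinv) with h | h
  · have hA1 : A = 1 := by
      ext x
      rw [← hmemE, h, IntermediateField.mem_bot, Submodule.mem_one]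
      rfl
    have hr1 : r = 1 := by
      rw [← hAr, hA1, Submodule.one_eq_span, finrank_span_singleton one_ne_zero]
    rw [hA1, one_mul] at hAV
    have := (hmin V hPV).1
    omega
  · exfalso
    apply hPA.2
    have : A = ⊤ := by
      ext x
      rw [← hmemE, h]
      simp
    exact top_le_iff.1 (this ▸ hle A)

end Isoperimetric

section Derivations

variable {k Ω : Type} [Field k] [Field Ω] [Algebra k Ω]

open TensorProduct KaehlerDifferential in
theorem exists_derivation_extending {P : Type} [CommRing P] [Algebra k P] [Algebra P Ω]
    [IsScalarTower k P Ω] [Algebra.FormallyEtale P Ω] (D₀ : Derivation k P Ω) :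
    ∃ D : Derivation k Ω Ω, ∀ p, D (algebraMap P Ω p) = D₀ p := by
  let e := KaehlerDifferential.tensorKaehlerEquivOfFormallyEtale k P Ω
  let f : Ω ⊗[P] (Ω[P⁄k]) →ₗ[Ω] Ω := (D₀.liftKaehlerDifferential).liftBaseChange Ω
  refine ⟨(f ∘ₗ e.symm.toLinearMap).compDer (KaehlerDifferential.D k Ω), fun p => ?_⟩
  have := KaehlerDifferential.tensorKaehlerEquivOfFormallyEtale_symm_D_algebraMap k P Ω p
  simp [e, f, this]

theorem formallyEtale_of_isAlgebraic [CharZero Ω] {P : Type} [CommRing P] [IsDomain P]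
    [Algebra P Ω] [FaithfulSMul P Ω] [Algebra.IsAlgebraic P Ω] : Algebra.FormallyEtale P Ω := by
  let := FractionRing.liftAlgebra P Ω
  have : CharZero P := (algebraMap P Ω).charZero
  have : CharZero (FractionRing P) :=
    charZero_of_injective_algebraMap (IsFractionRing.injective P (FractionRing P))
  have : Algebra.IsAlgebraic (FractionRing P) Ω :=
    Algebra.IsAlgebraic.extendScalars (IsFractionRing.injective P (FractionRing P))
  have : Algebra.FormallyEtale (FractionRing P) Ω := Algebra.FormallyEtale.of_isSeparable _ _
  have : Algebra.FormallyEtale P (FractionRing P) :=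
    Algebra.FormallyEtale.of_isLocalization (nonZeroDivisors P)
  exact Algebra.FormallyEtale.comp P (FractionRing P) Ω

theorem isAlgebraic_mvPolynomial {ι : Type} {t : ι → Ω} (ht : IsTranscendenceBasis k t) :
    letI : Algebra (MvPolynomial ι k) Ω := (aeval (R := k) t).toAlgebra
    Algebra.IsAlgebraic (MvPolynomial ι k) Ω := by
  let _ : Algebra (MvPolynomial ι k) Ω := (aeval (R := k) t).toAlgebra
  have h := ht.isAlgebraic
  refine ⟨fun x => ?_⟩
  obtain ⟨p, hp0, hp⟩ := h.isAlgebraic x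
  have hsurj : ∀ a : Algebra.adjoin k (Set.range t), ∃ q : MvPolynomial ι k,
      algebraMap _ Ω q = a := by
    rintro ⟨a, ha⟩
    rw [Algebra.adjoin_range_eq_range_aeval] at ha
    exact ha
  let e : MvPolynomial ι k ≃ₐ[k] Algebra.adjoin k (Set.range t) := ht.1.aevalEquiv
  have he : ∀ a, algebraMap _ Ω (e a) = algebraMap (MvPolynomial ι k) Ω a := fun a =>
    ht.1.algebraMap_aevalEquiv a
  refine ⟨p.map (e.symm : _ →+* _), ?_, ?_⟩
  · rw [Polynomial.map_ne_zero_iff]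
    · exact hp0
    · exact e.symm.injective
  · rw [Polynomial.aeval_def, Polynomial.eval₂_map, ← hp, Polynomial.aeval_def]
    congr 1
    ext a
    have := he (e.symm a)
    simp only [AlgEquiv.apply_symm_apply] at this
    exact this.symm

/-- In characteristic zero a derivation can be prescribed arbitrarily on a transcendence basis. -/
theorem exists_derivation_of_isTranscendenceBasis [CharZero Ω] {ι : Type} {t : ι → Ω}
    (ht : IsTranscendenceBasis k t) (w : ι → Ω) :
    ∃ D : Derivation k Ω Ω, ∀ i, D (t i) = w i := by
  let : Algebra (MvPolynomial ι k) Ω := (aeval (R := k) t).toAlgebra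
  have hmap : ∀ p, algebraMap (MvPolynomial ι k) Ω p = aeval t p := fun _ => rfl
  have : IsScalarTower k (MvPolynomial ι k) Ω :=
    IsScalarTower.of_algebraMap_eq (fun x => by simp [hmap, MvPolynomial.algebraMap_eq])
  have : FaithfulSMul (MvPolynomial ι k) Ω :=
    (faithfulSMul_iff_algebraMap_injective _ _).2 ht.1
  have : Algebra.IsAlgebraic (MvPolynomial ι k) Ω := isAlgebraic_mvPolynomial ht
  have : Algebra.FormallyEtale (MvPolynomial ι k) Ω := formallyEtale_of_isAlgebraic
  obtain ⟨D, hD⟩ := exists_derivation_extending (k := k) (Ω := Ω)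
    (MvPolynomial.mkDerivation k (A := Ω) w)
  refine ⟨D, fun i => ?_⟩
  have := hD (X i)
  rwa [hmap, aeval_X, mkDerivation_X] at this

theorem derivation_sum_apply {ι : Type} (s : Finset ι) (d : ι → Derivation k Ω Ω) (x : Ω) :
    (∑ i ∈ s, d i) x = ∑ i ∈ s, d i x := by
  classical
  induction s using Finset.induction_on with
  | empty => simp
  | insert a s ha ih => rw [Finset.sum_insert ha, Finset.sum_insert ha, Derivation.add_apply, ih]

/-- The field of constants of a derivation. -/
def constants (D : Derivation k Ω Ω) : IntermediateField k Ω where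
  carrier := {x | D x = 0}
  mul_mem' := by
    intro a b ha hb
    simp only [Set.mem_ofPred_eq] at ha hb ⊢
    simp [ha, hb]
  add_mem' := by
    intro a b ha hb
    simp only [Set.mem_ofPred_eq] at ha hb ⊢
    simp [ha, hb]
  algebraMap_mem' := by intro r; simp
  inv_mem' := by
    intro x hx
    simp only [Set.mem_ofPred_eq] at hx ⊢
    rw [Derivation.leibniz_inv, hx, smul_zero]

theorem mem_constants {D : Derivation k Ω Ω} {x : Ω} : x ∈ constants D ↔ D x = 0 := Iff.rfl

theorem mem_constants_of_isAlgebraic [CharZero Ω] (D : Derivation k Ω Ω) {x : Ω}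
    (hx : IsAlgebraic (constants D) x) : D x = 0 := by
  let D' : Derivation (constants D) Ω Ω :=
    { toFun := D
      map_add' := map_add D
      map_smul' := by
        intro a y
        have ha : D (a : Ω) = 0 := a.2
        simp [Algebra.smul_def, IntermediateField.algebraMap_apply, ha]
      map_one_eq_zero' := by simp
      leibniz' := by
        intro a b
        simp }
  have hint := hx.isIntegral
  have h := Derivation.map_aeval D' (minpoly (constants D) x) x
  rw [minpoly.aeval, map_zero, smul_eq_mul] at h
  have hsep : (minpoly (constants D) x).Separable := (minpoly.irreducible hint).separable
  have hne := hsep.aeval_derivative_ne_zero (minpoly.aeval _ x)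
  exact (mul_eq_zero.1 h.symm).resolve_left hne

theorem derivation_eq_zero_of_isAlgebraic [CharZero Ω] (D : Derivation k Ω Ω) (S : Set Ω)
    (hS : ∀ s ∈ S, D s = 0) {x : Ω} (hx : IsAlgebraic (Algebra.adjoin k S) x) : D x = 0 := by
  apply mem_constants_of_isAlgebraic
  have hle : Algebra.adjoin k S ≤ (constants D).toSubalgebra :=
    Algebra.adjoin_le (fun s hs => hS s hs)
  obtain ⟨p, hp0, hp⟩ := hx
  have hinj : Function.Injective (Subalgebra.inclusion hle) := Subalgebra.inclusion_injective hle
  refine ⟨p.map (Subalgebra.inclusion hle : _ →+* (constants D)), ?_, ?_⟩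
  · rwa [Polynomial.map_ne_zero_iff]
    exact hinj
  · rw [Polynomial.aeval_def, Polynomial.eval₂_map, ← hp, Polynomial.aeval_def]
    rfl

theorem derivation_eq_zero [CharZero Ω] {ι : Type} {t : ι → Ω}
    (ht : IsTranscendenceBasis k t) (D : Derivation k Ω Ω) (h : ∀ i, D (t i) = 0) (x : Ω) :
    D x = 0 := by
  have := ht.isAlgebraic
  apply derivation_eq_zero_of_isAlgebraic D (Set.range t)
  · rintro _ ⟨i, rfl⟩; exact h i
  · exact this.isAlgebraic x

/-- `d` is the family of partial derivatives dual to the transcendence basis `t`. -/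
def IsDual {ι : Type} [DecidableEq ι] (t : ι → Ω) (d : ι → Derivation k Ω Ω) : Prop :=
  ∀ i j, d i (t j) = if i = j then 1 else 0

theorem exists_isDual [CharZero Ω] {ι : Type} [DecidableEq ι] {t : ι → Ω}
    (ht : IsTranscendenceBasis k t) : ∃ d : ι → Derivation k Ω Ω, IsDual t d :=
  ⟨fun i => (exists_derivation_of_isTranscendenceBasis ht (fun j => if i = j then 1 else 0)).choose,
    fun i => (exists_derivation_of_isTranscendenceBasis ht
      (fun j => if i = j then 1 else 0)).choose_spec⟩

theorem IsDual.comm [CharZero Ω] {ι : Type} [DecidableEq ι] {t : ι → Ω}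
    {d : ι → Derivation k Ω Ω} (hd : IsDual t d) (ht : IsTranscendenceBasis k t) (i j : ι)
    (x : Ω) : d i (d j x) = d j (d i x) := by
  have := derivation_eq_zero ht ⁅d i, d j⁆ (fun l => by
    rw [Derivation.commutator_apply, hd, hd]
    split_ifs <;> simp) x
  rw [Derivation.commutator_apply] at this
  exact sub_eq_zero.1 this

theorem IsDual.mem_range_of_forall_eq_zero [CharZero Ω] [IsAlgClosed k] {ι : Type} [Fintype ι]
    [DecidableEq ι] {t : ι → Ω}
    {d : ι → Derivation k Ω Ω} (hd : IsDual t d) (ht : IsTranscendenceBasis k t) {x : Ω}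
    (hx : ∀ i, d i x = 0) : ∃ a : k, algebraMap k Ω a = x := by
  by_cases halg : IsAlgebraic k x
  · exact minpoly.mem_range_of_degree_eq_one k x
      (IsAlgClosed.degree_eq_one_of_irreducible k (minpoly.irreducible halg.isIntegral))
  · exfalso
    have hind : AlgebraicIndepOn k id ({x} : Set Ω) :=
      (algebraicIndependent_unique_type_iff (ι := ({x} : Set Ω))).2 halg
    obtain ⟨s, hs, hst⟩ := exists_isTranscendenceBasis_superset hind
    obtain ⟨D, hD⟩ := exists_derivation_of_isTranscendenceBasis hst (fun _ => 1)
    have hx1 : D x = 1 := hD ⟨x, hs rfl⟩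
    have := derivation_eq_zero ht (D - ∑ i, D (t i) • d i) (fun j => by
      simp [derivation_sum_apply, hd _ j]) x
    simp [derivation_sum_apply, hx, hx1] at this

theorem derivation_div_eq_zero {D : Derivation k Ω Ω} {x y : Ω} (hx : D x = 0) (hy : D y = 0) :
    D (x / y) = 0 :=
  (constants D).div_mem hx hy

/-- The field of elements constant for all `d j`, `j ∈ J`. -/
def constantsOn {ι : Type} (d : ι → Derivation k Ω Ω) (J : Set ι) : IntermediateField k Ω :=
  ⨅ j : J, constants (d j)

theorem mem_constantsOn {ι : Type} {d : ι → Derivation k Ω Ω} {J : Set ι} {x : Ω} :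
    x ∈ constantsOn d J ↔ ∀ j ∈ J, d j x = 0 := by
  rw [constantsOn, ← SetLike.mem_coe, IntermediateField.coe_iInf]
  simp [mem_constants]

end Derivations

section LinearDisjointness

variable {k Ω : Type} [Field k] [Field Ω] [Algebra k Ω] [CharZero Ω] [IsAlgClosed k]
  {ι : Type} [Fintype ι] [DecidableEq ι] {t : ι → Ω} {d : ι → Derivation k Ω Ω}

/-- Elements which are constant for the `d i`, `i ∉ J`, and linearly independent over `k`, remain
linearly independent over the elements which are constant for the `d j`, `j ∈ J`. -/
theorem IsDual.eq_zero_of_sum_mul_eq_zero (ht : IsTranscendenceBasis k t) (hd : IsDual t d)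
    {σ : Type} {x : σ → Ω} (hx : LinearIndependent k x) (J : Set ι)
    (hxJ : ∀ i ∉ J, ∀ s, d i (x s) = 0) (S : Finset σ) :
    ∀ c : σ → Ω, (∀ j ∈ J, ∀ s ∈ S, d j (c s) = 0) → ∑ s ∈ S, c s * x s = 0 →
      ∀ s ∈ S, c s = 0 := by
  classical
  induction S using Finset.strongInduction with
  | H S ih =>
    intro c hc h s₀ hs₀
    by_contra hne
    set c' : σ → Ω := fun s => c s / c s₀ with hc'
    have h1 : c' s₀ = 1 := div_self hne
    have hc'J : ∀ j ∈ J, ∀ s ∈ S, d j (c' s) = 0 := fun j hj s hs =>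
      derivation_div_eq_zero (hc j hj s hs) (hc j hj s₀ hs₀)
    have h' : ∑ s ∈ S, c' s * x s = 0 := by
      have : ∑ s ∈ S, c' s * x s = (c s₀)⁻¹ * ∑ s ∈ S, c s * x s := by
        rw [Finset.mul_sum]
        refine Finset.sum_congr rfl fun s _ => ?_
        simp only [hc', div_eq_mul_inv]; ring
      rw [this, h, mul_zero]
    have hconst : ∀ i, ∀ s ∈ S, d i (c' s) = 0 := by
      intro i
      by_cases hi : i ∈ J
      · exact hc'J i hi
      have hsum : ∑ s ∈ S.erase s₀, d i (c' s) * x s = 0 := by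
        have h2 := congrArg (d i) h'
        rw [map_sum, map_zero] at h2
        rw [← h2, ← Finset.sum_erase_add _ _ hs₀]
        simp only [Derivation.leibniz, h1, hxJ i hi, smul_eq_mul, mul_zero, zero_add,
          Derivation.map_one_eq_zero, add_zero]
        exact Finset.sum_congr rfl fun s _ => mul_comm _ _
      have h3 := ih _ (Finset.erase_ssubset hs₀) (fun s => d i (c' s)) (fun j hj s hs => by
        rw [hd.comm ht, hc'J j hj s (Finset.mem_of_mem_erase hs), map_zero]) hsum
      intro s hs
      by_cases hss : s = s₀
      · rw [hss, h1, Derivation.map_one_eq_zero]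
      · exact h3 s (Finset.mem_erase.2 ⟨hss, hs⟩)
    have hk : ∀ s, ∃ a : k, s ∈ S → algebraMap k Ω a = c' s := by
      intro s
      by_cases hs : s ∈ S
      · obtain ⟨a, ha⟩ := hd.mem_range_of_forall_eq_zero ht (fun i => hconst i s hs)
        exact ⟨a, fun _ => ha⟩
      · exact ⟨0, fun h => absurd h hs⟩
    choose a ha using hk
    have h4 : ∑ s ∈ S, a s • x s = 0 := by
      rw [← h']
      refine Finset.sum_congr rfl fun s hs => ?_
      rw [Algebra.smul_def, ha s hs]
    have h5 := linearIndependent_iff'.1 hx S a h4 s₀ hs₀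
    have h6 := ha s₀ hs₀
    rw [h5, h1, map_zero] at h6
    exact zero_ne_one h6

theorem IsDual.span_eq_top_of_mem (ht : IsTranscendenceBasis k t) (hd : IsDual t d)
    {σ : Type} [Fintype σ] {x : σ → Ω} (hx : LinearIndependent k x) (J : Set ι)
    (hxJ : ∀ i ∉ J, ∀ s, d i (x s) = 0) (G : Set (σ → Ω))
    (hG : ∀ g ∈ G, ∀ j ∈ J, ∀ s, d j (g s) = 0) (hmem : x ∈ Submodule.span Ω G) :
    Submodule.span Ω G = ⊤ := by
  classical
  set E := constantsOn d J with hE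
  let G' : Set (σ → E) := {g | (fun s => (g s : Ω)) ∈ G}
  by_cases htop : Submodule.span E G' = ⊤
  · rw [eq_top_iff, ← (Pi.basisFun Ω σ).span_eq, Submodule.span_le]
    rintro _ ⟨s, rfl⟩
    let L : (σ → E) →ₗ[E] (σ → Ω) :=
      { toFun := fun g s => (g s : Ω)
        map_add' := by intros; rfl
        map_smul' := by intros; rfl }
    have h1 : (Pi.single s 1 : σ → E) ∈ Submodule.span E G' := htop ▸ Submodule.mem_top
    have h2 : Submodule.span E G' ≤ ((Submodule.span Ω G).restrictScalars E).comap L := by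
      rw [Submodule.span_le]
      intro g hg
      exact Submodule.subset_span (s := G) hg
    have h3 := h2 h1
    have h4 : L (Pi.single s 1) = Pi.basisFun Ω σ s := by
      ext s'
      by_cases h : s' = s
      · subst h; simp [L]
      · simp [L, h]
    rw [Submodule.mem_comap, h4] at h3
    exact h3
  · exfalso
    obtain ⟨f, hf0, hf⟩ := Submodule.exists_le_ker_of_lt_top _ (lt_top_iff_ne_top.2 htop)
    set lam : σ → E := fun s => f (Pi.single s 1) with hlam
    have hfe : ∀ g, f g = ∑ s, g s * lam s := by
      intro g
      conv_lhs => rw [pi_eq_sum_univ' g]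
      simp [hlam, map_sum, Pi.single]
    let ℓ : (σ → Ω) →ₗ[Ω] Ω := ∑ s, (lam s : Ω) • LinearMap.proj s
    have hℓ : ∀ v, ℓ v = ∑ s, (lam s : Ω) * v s := by intro v; simp [ℓ]
    have h1 : Submodule.span Ω G ≤ LinearMap.ker ℓ := by
      rw [Submodule.span_le]
      intro g hg
      have hg' : ∀ s, g s ∈ E := fun s => mem_constantsOn.2 (fun j hj => hG g hg j hj s)
      have h2 : (fun s => (⟨g s, hg' s⟩ : E)) ∈ Submodule.span E G' := Submodule.subset_span hg
      have h3 := hf h2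
      rw [LinearMap.mem_ker, hfe] at h3
      have h4 := congrArg (algebraMap E Ω) h3
      rw [SetLike.mem_coe, LinearMap.mem_ker, hℓ]
      simpa [map_sum, mul_comm] using h4
    have h2 := h1 hmem
    rw [LinearMap.mem_ker, hℓ] at h2
    have h3 := hd.eq_zero_of_sum_mul_eq_zero ht hx J hxJ Finset.univ (fun s => (lam s : Ω))
      (fun j hj s _ => mem_constantsOn.1 (lam s).2 j hj) h2
    apply hf0
    refine LinearMap.ext fun g => ?_
    rw [hfe]
    have : ∀ s, lam s = 0 := fun s => by
      have := h3 s (Finset.mem_univ s)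
      exact_mod_cast this
    simp [this]

end LinearDisjointness

section GenericPoints

variable {k : Type} [Field k]

/-- A field map can be prescribed on a transcendence basis, with values in an algebraically
closed field. -/
theorem exists_algHom_of_isTranscendenceBasis {K Ω : Type} [Field K] [Algebra k K] [Field Ω]
    [Algebra k Ω] [IsAlgClosed Ω] {β : Type} {z : β → K} (hz : IsTranscendenceBasis k z)
    {w : β → Ω} (hw : AlgebraicIndependent k w) : ∃ φ : K →ₐ[k] Ω, ∀ j, φ (z j) = w j := by
  let _ : Algebra (MvPolynomial β k) K := (aeval (R := k) z).toAlgebra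
  let _ : Algebra (MvPolynomial β k) Ω := (aeval (R := k) w).toAlgebra
  have hK : ∀ p, algebraMap (MvPolynomial β k) K p = aeval z p := fun _ => rfl
  have hΩ : ∀ p, algebraMap (MvPolynomial β k) Ω p = aeval w p := fun _ => rfl
  have : IsScalarTower k (MvPolynomial β k) K :=
    IsScalarTower.of_algebraMap_eq (fun x => by simp [hK, MvPolynomial.algebraMap_eq])
  have : IsScalarTower k (MvPolynomial β k) Ω :=
    IsScalarTower.of_algebraMap_eq (fun x => by simp [hΩ, MvPolynomial.algebraMap_eq])
  have : FaithfulSMul (MvPolynomial β k) K :=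
    (faithfulSMul_iff_algebraMap_injective _ _).2 hz.1
  have : FaithfulSMul (MvPolynomial β k) Ω :=
    (faithfulSMul_iff_algebraMap_injective _ _).2 hw
  have : Algebra.IsAlgebraic (MvPolynomial β k) K := isAlgebraic_mvPolynomial hz
  let f : K →ₐ[MvPolynomial β k] Ω := IsAlgClosed.lift
  refine ⟨f.restrictScalars k, fun j => ?_⟩
  have := f.commutes (X j)
  rwa [hK, hΩ, aeval_X, aeval_X] at this

theorem isAlgebraic_adjoin_map {K Ω : Type} [Field K] [Algebra k K] [Field Ω]
    [Algebra k Ω] (φ : K →ₐ[k] Ω) {S : Set K} {x : K} (hx : IsAlgebraic (Algebra.adjoin k S) x) :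
    IsAlgebraic (Algebra.adjoin k (φ '' S)) (φ x) := by
  obtain ⟨p, hp0, hp⟩ := hx
  have hmem : ∀ a : Algebra.adjoin k S, φ a ∈ Algebra.adjoin k (φ '' S) := by
    rintro ⟨a, ha⟩
    rw [Algebra.adjoin_image]
    exact ⟨a, ha, rfl⟩
  let g : Algebra.adjoin k S →+* Algebra.adjoin k (φ '' S) :=
    ((φ.comp (Algebra.adjoin k S).val).codRestrict _ hmem : _ →ₐ[k] _)
  have hg : Function.Injective g := by
    intro a b hab
    have : φ a = φ b := congrArg Subtype.val hab
    exact Subtype.ext (φ.injective this)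
  refine ⟨p.map g, by rwa [Polynomial.map_ne_zero_iff hg], ?_⟩
  rw [Polynomial.aeval_def, Polynomial.eval₂_map]
  have h2 := congrArg φ hp
  rw [Polynomial.aeval_def, map_zero] at h2
  rw [← h2]
  exact (Polynomial.hom_eval₂ p _ (φ : K →+* Ω) x).symm

theorem derivation_comp_eq_zero {K Ω : Type} [Field K] [Algebra k K] [Field Ω]
    [Algebra k Ω] [CharZero Ω] (φ : K →ₐ[k] Ω) {β : Type} {z : β → K}
    (hz : IsTranscendenceBasis k z) (D : Derivation k Ω Ω) (h : ∀ j, D (φ (z j)) = 0) (x : K) :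
    D (φ x) = 0 := by
  have := hz.isAlgebraic.isAlgebraic x
  refine derivation_eq_zero_of_isAlgebraic D (φ '' Set.range z) ?_ (isAlgebraic_adjoin_map φ this)
  rintro _ ⟨_, ⟨j, rfl⟩, rfl⟩
  exact h j

/-- A field containing independent generic points, indexed by `α`, of the model of `K/k` with
transcendence basis `z`. -/
theorem exists_generic_points {K : Type} [Field K] [Algebra k K] {α β : Type} {z : β → K}
    (hz : IsTranscendenceBasis k z) :
    ∃ (Ω : Type) (_ : Field Ω) (_ : Algebra k Ω) (φ : α → K →ₐ[k] Ω),
      IsTranscendenceBasis k (fun q : α × β => φ q.1 (z q.2)) := by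
  let Q := FractionRing (MvPolynomial (α × β) k)
  let Ω := AlgebraicClosure Q
  have h0 : IsTranscendenceBasis k
      (fun q : α × β => algebraMap (MvPolynomial (α × β) k) Ω (X q)) := by
    have h := (IsTranscendenceBasis.mvPolynomial (α × β) k)
    have : Algebra.IsAlgebraic (MvPolynomial (α × β) k) Ω :=
      (IsFractionRing.comap_isAlgebraic_iff (K := Q)).2 inferInstance
    have : FaithfulSMul (MvPolynomial (α × β) k) Ω := FaithfulSMul.trans _ Q _
    exact h.algebraMap_comp (A := Ω)
  have h1 : ∀ a : α, ∃ φ : K →ₐ[k] Ω, ∀ j,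
      φ (z j) = algebraMap (MvPolynomial (α × β) k) Ω (X (a, j)) := fun a =>
    exists_algHom_of_isTranscendenceBasis hz (w := fun j =>
      algebraMap (MvPolynomial (α × β) k) Ω (X (a, j)))
      (h0.1.comp (fun j => (a, j)) (fun j j' h => (Prod.mk.inj h).2))
  choose φ hφ using h1
  refine ⟨Ω, inferInstance, inferInstance, φ, ?_⟩
  simpa [hφ] using h0

theorem finrank_sup_span_image_ge {F V : Type} [Field F] [AddCommGroup V] [Module F V]
    [FiniteDimensional F V] {α : Type} [DecidableEq α] (U : Submodule F V) (x : α → V)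
    (T : Finset α)
    (h : ∀ T' ⊆ T, ∀ b ∈ T, b ∉ T' → x b ∈ U ⊔ Submodule.span F (x '' T') →
      U ⊔ Submodule.span F (x '' T') = ⊤)
    (hcard : Module.finrank F U + T.card ≤ Module.finrank F V) :
    Module.finrank F U + T.card ≤
      Module.finrank F (U ⊔ Submodule.span F (x '' T) : Submodule F V) := by
  induction T using Finset.induction_on with
  | empty => simpa only [Finset.card_empty, add_zero] using Submodule.finrank_mono le_sup_left
  | insert b T hb ih =>
    rw [Finset.card_insert_of_notMem hb] at hcard ⊢
    have h1 := ih (fun T' hT' c hc => h T' (hT'.trans (Finset.subset_insert _ _)) c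
      (Finset.mem_insert_of_mem hc)) (by omega)
    have hle : U ⊔ Submodule.span F (x '' T) ≤
        U ⊔ Submodule.span F (x '' (insert b T : Finset α)) :=
      sup_le_sup_left (Submodule.span_mono (Set.image_mono (by simp))) _
    by_cases hmem : x b ∈ U ⊔ Submodule.span F (x '' T)
    · have h2 := h T (Finset.subset_insert _ _) b (Finset.mem_insert_self _ _) hb hmem
      rw [h2, top_le_iff] at hle
      rw [hle, finrank_top]
      omega
    · have hlt : U ⊔ Submodule.span F (x '' T) <
          U ⊔ Submodule.span F (x '' (insert b T : Finset α)) := by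
        refine lt_of_le_of_ne hle fun heq => hmem ?_
        rw [heq]
        exact le_sup_right (a := U) (Submodule.subset_span ⟨b, by simp, rfl⟩)
      have := Submodule.finrank_lt_finrank_of_lt hlt
      omega

end GenericPoints

section

variable {k K Ω : Type} [Field k] [Field K] [Algebra k K] [Field Ω]
  [Algebra k Ω] {α β : Type} [DecidableEq α] [DecidableEq β]
  {x : α ⊕ β → K} {φ : α → K →ₐ[k] Ω} {d : α × β → Derivation k Ω Ω}

theorem derivation_generic_point_eq_zero [CharZero Ω]
    (hz : IsTranscendenceBasis k (fun j => x (Sum.inr j)))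
    (hd : IsDual (fun q : α × β => φ q.1 (x (Sum.inr q.2))) d) {a b : α} (hab : a ≠ b) (l : β)
    (w : K) : d (a, l) (φ b w) = 0 := by
  refine derivation_comp_eq_zero (φ b) hz (d (a, l)) (fun j => ?_) w
  have := hd (a, l) (b, j)
  simpa [hab] using this

end

section GenericSpans

variable {k K Ω : Type} [Field k] [IsAlgClosed k] [Field K] [Algebra k K] [Field Ω]
  [Algebra k Ω] {α β : Type} [Fintype α] [DecidableEq α] [Fintype β] [DecidableEq β]
  {x : α ⊕ β → K} {φ : α → K →ₐ[k] Ω} {d : α × β → Derivation k Ω Ω}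

theorem span_generic_points_eq_top [CharZero Ω]
    (hx : LinearIndependent k (fun i => x (Sum.inl i)))
    (ht : IsTranscendenceBasis k (fun q : α × β => φ q.1 (x (Sum.inr q.2))))
    (hz : IsTranscendenceBasis k (fun j => x (Sum.inr j)))
    (hd : IsDual (fun q : α × β => φ q.1 (x (Sum.inr q.2))) d) :
    Submodule.span Ω (Set.range fun a : α => fun i : α => φ a (x (Sum.inl i))) = ⊤ := by
  set p : α → α → Ω := fun a i => φ a (x (Sum.inl i)) with hp
  have h := finrank_sup_span_image_ge (F := Ω) (V := α → Ω) ⊥ p Finset.univ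
    (by
      intro T' _ b _ hb hmem
      rw [bot_sup_eq] at hmem ⊢
      refine hd.span_eq_top_of_mem ht (x := p b)
        (hx.map' (φ b).toLinearMap (LinearMap.ker_eq_bot.2 (φ b).injective))
        {q | q.1 = b} ?_ _ ?_ hmem
      · rintro ⟨a, l⟩ ha i
        exact derivation_generic_point_eq_zero hz hd ha l _
      · rintro _ ⟨a, ha, rfl⟩ ⟨_, l⟩ rfl i
        refine derivation_generic_point_eq_zero hz hd ?_ l _
        rintro rfl
        exact hb ha)
    (by simp)
  rw [bot_sup_eq, finrank_bot, zero_add, Finset.coe_univ, Set.image_univ] at h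
  exact Submodule.eq_top_of_finrank_eq (le_antisymm (Submodule.finrank_le _) (by simpa using h))

theorem span_tangent_sup_generic_points_eq_top [CharZero Ω] (hx : LinearIndependent k x)
    {i₀ : α} (hi₀ : x (Sum.inl i₀) = 1)
    (ht : IsTranscendenceBasis k (fun q : α × β => φ q.1 (x (Sum.inr q.2))))
    (hz : IsTranscendenceBasis k (fun j => x (Sum.inr j)))
    (hd : IsDual (fun q : α × β => φ q.1 (x (Sum.inr q.2))) d) (a : α) :
    Submodule.span Ω (Set.range (fun o : Option β => fun s =>
      o.elim (φ a (x s)) (fun l => d (a, l) (φ a (x s))))) ⊔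
      Submodule.span Ω ((fun b : α => fun s => φ b (x s)) '' (Finset.univ.erase a : Finset α)) =
      ⊤ := by
  set p : α → α ⊕ β → Ω := fun a s => φ a (x s) with hp
  set g : Option β → α ⊕ β → Ω := fun o s =>
      o.elim (φ a (x s)) (fun l => d (a, l) (φ a (x s))) with hg
  have hδ : ∀ l j, d (a, l) (φ a (x (Sum.inr j))) = if l = j then 1 else 0 := fun l j => by
    have := hd (a, l) (a, j)
    simpa using this
  have hgi : LinearIndependent Ω g := by
    rw [Fintype.linearIndependent_iff]
    intro c hc
    have h0 : c none = 0 := by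
      have := congrFun hc (Sum.inl i₀)
      simpa [Fintype.sum_option, hg, hi₀] using this
    have h1 : ∀ l, c (some l) = 0 := by
      intro l
      have := congrFun hc (Sum.inr l)
      simpa [Fintype.sum_option, hg, h0, hδ] using this
    intro o
    cases o with
    | none => exact h0
    | some l => exact h1 l
  have hfin : Module.finrank Ω (Submodule.span Ω (Set.range g)) = Fintype.card β + 1 := by
    rw [finrank_span_eq_card hgi, Fintype.card_option]
  have hcard : (Finset.univ.erase a : Finset α).card + 1 = Fintype.card α := by
    rw [Finset.card_erase_add_one (Finset.mem_univ a), Finset.card_univ]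
  have hV : Module.finrank Ω (α ⊕ β → Ω) = Fintype.card α + Fintype.card β := by simp
  have h := finrank_sup_span_image_ge (F := Ω) (V := α ⊕ β → Ω) (Submodule.span Ω (Set.range g))
    p (Finset.univ.erase a)
    (by
      intro T' _ b hbT hb hmem
      have hba : b ≠ a := (Finset.mem_erase.1 hbT).1
      rw [← Submodule.span_union] at hmem ⊢
      refine hd.span_eq_top_of_mem ht (x := p b)
        (hx.map' (φ b).toLinearMap (LinearMap.ker_eq_bot.2 (φ b).injective))
        {q | q.1 = b} ?_ _ ?_ hmem
      · rintro ⟨a, l⟩ ha i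
        exact derivation_generic_point_eq_zero hz hd ha l _
      · rintro _ (⟨o, rfl⟩ | ⟨a, ha, rfl⟩) ⟨_, l⟩ rfl i
        · cases o with
          | none => exact derivation_generic_point_eq_zero hz hd hba l _
          | some j =>
            change d _ (d _ _) = 0
            rw [hd.comm ht, derivation_generic_point_eq_zero hz hd hba l, map_zero]
        · refine derivation_generic_point_eq_zero hz hd ?_ l _
          rintro rfl
          exact hb ha)
    (by omega)
  exact Submodule.eq_top_of_finrank_eq (le_antisymm (Submodule.finrank_le _) (by omega))

end GenericSpans

section GenericMatrix

theorem isAlgebraic_adjoin_of_forall_derivation {k Ω : Type} [Field k] [Field Ω] [Algebra k Ω]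
    [CharZero Ω] (S : Set Ω)
    (h : ∀ D : Derivation k Ω Ω, (∀ s ∈ S, D s = 0) → ∀ x, D x = 0) :
    Algebra.IsAlgebraic (Algebra.adjoin k S) Ω := by
  let E := IntermediateField.adjoin k S
  obtain ⟨ι, t, ht⟩ := exists_isTranscendenceBasis' E Ω
  have hE : Algebra.IsAlgebraic E Ω := by
    rw [← ht.isEmpty_iff_isAlgebraic]
    by_contra hne
    rw [not_isEmpty_iff] at hne
    obtain ⟨i⟩ := hne
    obtain ⟨D, hD⟩ := exists_derivation_of_isTranscendenceBasis ht (fun _ => 1)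
    have := h (D.restrictScalars k) (fun s hs =>
      D.map_algebraMap (⟨s, IntermediateField.subset_adjoin k S hs⟩ : E)) (t i)
    have h1 : (D.restrictScalars k) (t i) = 1 := hD i
    exact one_ne_zero (h1.symm.trans this)
  open IntermediateField.algebraAdjoinAdjoin in
  exact (IsFractionRing.comap_isAlgebraic_iff (A := Algebra.adjoin k S) (K := E)).2 hE

theorem algebraicIndependent_of_forall_derivation {k Ω : Type} [Field k] [Field Ω] [Algebra k Ω]
    [CharZero Ω] {ι : Type} [Finite ι] {t : ι → Ω} (ht : IsTranscendenceBasis k t) (M : ι → Ω)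
    (h : ∀ D : Derivation k Ω Ω, (∀ i, D (M i) = 0) → ∀ i, D (t i) = 0) :
    AlgebraicIndependent k M := by
  have : Algebra.IsAlgebraic (Algebra.adjoin k (Set.range M)) Ω :=
    isAlgebraic_adjoin_of_forall_derivation _ fun D hD =>
      derivation_eq_zero ht D (h D fun i => hD _ ⟨i, rfl⟩)
  exact (Algebra.IsAlgebraic.isTranscendenceBasis_of_le_trdeg_of_finite k M
    ht.cardinalMk_eq_trdeg.le).1

theorem eq_zero_of_span_eq_top {Ω ι : Type} [Field Ω] [Fintype ι] {S : Set (ι → Ω)}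
    (hS : Submodule.span Ω S = ⊤) {g : ι → Ω} (h : ∀ v ∈ S, ∑ i, v i * g i = 0) : g = 0 := by
  classical
  let L : (ι → Ω) →ₗ[Ω] Ω := ∑ i, g i • LinearMap.proj i
  have hL : ∀ v, L v = ∑ i, v i * g i := fun v => by
    simp [L, LinearMap.sum_apply, mul_comm]
  have h0 : L = 0 := LinearMap.ext_on hS fun v hv => by rw [hL, h v hv]; rfl
  funext j
  have := hL (Pi.single j 1)
  rw [h0] at this
  simpa [Pi.single_apply] using this.symm

theorem exists_linear_solution {Ω α : Type} [Field Ω] [Fintype α] {p : α → α → Ω}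
    (hp : Submodule.span Ω (Set.range p) = ⊤) (w : α → Ω) :
    ∃ m : α → Ω, ∀ a, ∑ i, p a i * m i = w a := by
  classical
  let L : (α → Ω) →ₗ[Ω] (α → Ω) := Matrix.mulVecLin (Matrix.of p)
  have hL : Function.Injective L := by
    rw [← LinearMap.ker_eq_bot, LinearMap.ker_eq_bot']
    intro g hg
    refine eq_zero_of_span_eq_top hp ?_
    rintro _ ⟨a, rfl⟩
    exact congrFun hg a
  obtain ⟨m, hm⟩ := (LinearMap.injective_iff_surjective.1 hL) w
  exact ⟨m, fun a => congrFun hm a⟩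

variable {k K Ω : Type} [Field k] [IsAlgClosed k] [Field K] [Algebra k K] [Field Ω]
  [Algebra k Ω] {α β : Type} [Fintype α] [DecidableEq α] [Fintype β] [DecidableEq β]
  {x : α ⊕ β → K} {φ : α → K →ₐ[k] Ω} {d : α × β → Derivation k Ω Ω}

theorem algebraicIndependent_matrix [CharZero Ω] (hx : LinearIndependent k x)
    {i₀ : α} (hi₀ : x (Sum.inl i₀) = 1)
    (ht : IsTranscendenceBasis k (fun q : α × β => φ q.1 (x (Sum.inr q.2))))
    (hz : IsTranscendenceBasis k (fun j => x (Sum.inr j)))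
    (hd : IsDual (fun q : α × β => φ q.1 (x (Sum.inr q.2))) d)
    {M : α → β → Ω}
    (hM : ∀ a j, ∑ i, φ a (x (Sum.inl i)) * M i j = φ a (x (Sum.inr j))) :
    AlgebraicIndependent k (fun q : α × β => M q.1 q.2) := by
  refine algebraicIndependent_of_forall_derivation ht _ fun D hD => ?_
  have hδ : ∀ b l j, d (b, l) (φ b (x (Sum.inr j))) = if l = j then 1 else 0 := fun b l j => by
    have := hd (b, l) (b, j)
    simpa using this
  have hDx : ∀ b w, D (φ b w) = ∑ l, D (φ b (x (Sum.inr l))) * d (b, l) (φ b w) := by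
    intro b w
    have := derivation_comp_eq_zero (φ b) hz
      (D - ∑ l, D (φ b (x (Sum.inr l))) • d (b, l)) (fun j => by
        simp [derivation_sum_apply, hδ]) w
    simp only [Derivation.sub_apply, derivation_sum_apply, Derivation.smul_apply,
      smul_eq_mul] at this
    exact sub_eq_zero.1 this
  rintro ⟨b, l⟩
  let r : Matrix β β Ω := Matrix.of fun l j =>
    (if l = j then 1 else 0) - ∑ i, d (b, l) (φ b (x (Sum.inl i))) * M i j
  have hrinj : Function.Injective r.mulVec := by
    have : Function.Injective r.mulVecLin := by
      rw [← LinearMap.ker_eq_bot, LinearMap.ker_eq_bot']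
      intro μ hμ
      have hμ' : ∀ l, ∑ j, r l j * μ j = 0 := fun l => congrFun hμ l
      have key := eq_zero_of_span_eq_top (S := _ ∪ _)
        (g := Sum.elim (fun i => - ∑ j, M i j * μ j) μ)
        ((Submodule.span_union _ _).trans
          (span_tangent_sup_generic_points_eq_top hx hi₀ ht hz hd b)) ?_
      · funext j
        exact congrFun key (Sum.inr j)
      have hp : ∀ a, ∑ s, φ a (x s) *
          (Sum.elim (fun i => - ∑ j, M i j * μ j) μ : α ⊕ β → Ω) s = 0 := by
        intro a
        simp only [Fintype.sum_sum_type, Sum.elim_inl, Sum.elim_inr]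
        simp only [← hM a, mul_neg, Finset.sum_neg_distrib, Finset.mul_sum, Finset.sum_mul]
        rw [Finset.sum_comm, neg_add_eq_zero]
        simp only [mul_assoc]
      rintro _ (⟨o, rfl⟩ | ⟨a, ha, rfl⟩)
      · cases o with
        | none => exact hp b
        | some l =>
          rw [← hμ' l]
          simp only [Fintype.sum_sum_type, Sum.elim_inl, Sum.elim_inr, Option.elim_some, hδ, r,
            Matrix.of_apply, sub_mul, Finset.sum_sub_distrib, mul_neg, Finset.sum_neg_distrib,
            Finset.mul_sum, Finset.sum_mul]
          rw [Finset.sum_comm, neg_add_eq_sub]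
          simp only [mul_assoc]
      · exact hp a
    exact this
  have hr := Matrix.vecMul_injective_iff_isUnit.2 (Matrix.mulVec_injective_iff_isUnit.1 hrinj)
  have hα : Matrix.vecMul (fun l => D (φ b (x (Sum.inr l)))) r = 0 := by
    funext j
    have h1 := congrArg D (hM b j)
    rw [map_sum] at h1
    simp only [Derivation.leibniz, smul_eq_mul] at h1
    rw [Finset.sum_congr rfl (fun i _ => by rw [hD (i, j), mul_zero, zero_add, hDx b])] at h1
    simp only [Matrix.vecMul, dotProduct, r, Matrix.of_apply, mul_sub, Finset.sum_sub_distrib,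
      Pi.zero_apply, mul_ite, mul_one, mul_zero, Finset.sum_ite_eq', Finset.mem_univ, if_true]
    rw [← h1, sub_eq_zero]
    simp only [Finset.mul_sum]
    rw [Finset.sum_comm]
    exact Finset.sum_congr rfl fun l _ => Finset.sum_congr rfl fun i _ => by ring
  have := hr (hα.trans (Matrix.zero_vecMul r).symm)
  exact congrFun this l

end GenericMatrix

section GenericQuadrics

theorem eq_zero_of_linearIndependent_of_sum_algebraMap {k Ω I S : Type} [Field k] [Field Ω]
    [Algebra k Ω] [Fintype I] [Fintype S] {B : I → S → k} (hB : LinearIndependent k B) {f : I → Ω}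
    (h : ∀ s, ∑ i, f i * algebraMap k Ω (B i s) = 0) : f = 0 := by
  classical
  have hB' : LinearMap.ker (Fintype.linearCombination k B) = ⊥ :=
    LinearMap.ker_eq_bot'.2 fun m hm => funext (Fintype.linearIndependent_iff.1 hB m hm)
  obtain ⟨g, hg⟩ := LinearMap.exists_leftInverse_of_injective _ hB'
  funext j
  have h1 : ∀ i, ∑ s, B i s * g (Pi.single s 1) j = if i = j then 1 else 0 := by
    intro i
    have h2 := congrArg (fun L => L (Pi.single i 1) j) hg
    simp only [LinearMap.comp_apply, Fintype.linearCombination_apply_single, one_smul,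
      LinearMap.id_apply] at h2
    rw [LinearMap.pi_apply_eq_sum_univ g (B i)] at h2
    simp only [Finset.sum_apply, Pi.smul_apply, smul_eq_mul, Pi.single_apply] at h2
    have h3 : ∀ s : S, (fun j => if s = j then (1 : k) else 0) = Pi.single s 1 := fun s => by
      funext j; simp [Pi.single_apply, eq_comm]
    simp only [h3] at h2
    rw [h2]
    simp [eq_comm]
  calc f j = ∑ i, f i * algebraMap k Ω (if i = j then 1 else 0) := by simp
    _ = ∑ s, (∑ i, f i * algebraMap k Ω (B i s)) * algebraMap k Ω (g (Pi.single s 1) j) := by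
      simp only [← h1, map_sum, map_mul, Finset.mul_sum, Finset.sum_mul]
      rw [Finset.sum_comm]
      simp only [mul_assoc]
    _ = 0 := by simp [h]

theorem forall_eq_zero_of_span_eq_top {Ω V : Type} [Field Ω] [AddCommGroup V] [Module Ω V]
    {S T : Set V} (hST : Submodule.span Ω S ⊔ Submodule.span Ω T = ⊤) {L : V →ₗ[Ω] Ω}
    (hS : ∀ v ∈ S, L v = 0) (hT : ∀ v ∈ T, L v = 0) : L = 0 := by
  rw [← Submodule.span_union] at hST
  exact LinearMap.ext_on hST fun v hv => by
    rcases hv with hv | hv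
    · rw [hS v hv]; rfl
    · rw [hT v hv]; rfl

variable {k K Ω : Type} [Field k] [IsAlgClosed k] [Field K] [Algebra k K] [Field Ω]
  [Algebra k Ω] {α β : Type} [Fintype α] [DecidableEq α] [Fintype β] [DecidableEq β]
  {x : α ⊕ β → K} {φ : α → K →ₐ[k] Ω} {d : α × β → Derivation k Ω Ω}

/-- The bilinear form with matrix `∑ i, f i • B i`. -/
def combinedForm {S I : Type} [Fintype S] [DecidableEq S] [Fintype I] (B : I → S → S → k)
    (f : I → Ω) : (S → Ω) →ₗ[Ω] (S → Ω) →ₗ[Ω] Ω :=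
  Matrix.toBilin' (Matrix.of fun s t => ∑ i, f i * algebraMap k Ω (B i s t))

theorem combinedForm_apply {k Ω : Type} [Field k] [Field Ω] [Algebra k Ω] {S I : Type} [Fintype S]
    [DecidableEq S] [Fintype I] (B : I → S → S → k)
    (f : I → Ω) (v w : S → Ω) : combinedForm B f v w =
      ∑ i, f i * ∑ s, ∑ t, algebraMap k Ω (B i s t) * (v s * w t) := by
  rw [combinedForm, Matrix.toBilin'_apply]
  simp only [Matrix.of_apply, Finset.mul_sum, Finset.sum_mul]
  simp only [Finset.sum_comm (s := (Finset.univ : Finset S)) (t := (Finset.univ : Finset I))]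
  exact Finset.sum_congr rfl fun i _ => Finset.sum_congr rfl fun s _ =>
    Finset.sum_congr rfl fun t _ => by ring

theorem eq_zero_of_combinedForm_generic_points [CharZero Ω] (hx : LinearIndependent k x)
    {i₀ : α} (hi₀ : x (Sum.inl i₀) = 1)
    (ht : IsTranscendenceBasis k (fun q : α × β => φ q.1 (x (Sum.inr q.2))))
    (hz : IsTranscendenceBasis k (fun j => x (Sum.inr j)))
    (hd : IsDual (fun q : α × β => φ q.1 (x (Sum.inr q.2))) d) {I : Type} [Fintype I]
    {B : I → α ⊕ β → α ⊕ β → k} (hB : LinearIndependent k fun i => fun q : _ × _ => B i q.1 q.2)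
    (hsymm : ∀ i s t, B i s t = B i t s)
    (hBx : ∀ i, ∑ s, ∑ t, algebraMap k K (B i s t) * (x s * x t) = 0) {f : I → Ω}
    (hf : ∀ a b, combinedForm B f (fun s => φ a (x s)) (fun s => φ b (x s)) = 0) : f = 0 := by
  set q := combinedForm B f with hq
  have hqsymm : ∀ v w, q v w = q w v := fun v w => by
    rw [hq, combinedForm_apply, combinedForm_apply]
    refine Finset.sum_congr rfl fun i _ => ?_
    rw [Finset.sum_comm]
    refine congrArg _ (Finset.sum_congr rfl fun s _ => Finset.sum_congr rfl fun t _ => ?_)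
    rw [hsymm, mul_comm (v t)]
  have hder : ∀ (D : Derivation k Ω Ω) (i : I) (v w : α ⊕ β → Ω),
      D (∑ s, ∑ t, algebraMap k Ω (B i s t) * (v s * w t)) =
      ∑ s, ∑ t, algebraMap k Ω (B i s t) * (v s * D (w t)) +
      ∑ s, ∑ t, algebraMap k Ω (B i s t) * (D (v s) * w t) := by
    intro D i v w
    rw [map_sum, ← Finset.sum_add_distrib]
    refine Finset.sum_congr rfl fun s _ => ?_
    rw [map_sum, ← Finset.sum_add_distrib]
    refine Finset.sum_congr rfl fun t _ => ?_
    simp only [Derivation.leibniz, Derivation.map_algebraMap, smul_eq_mul]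
    ring
  have hp0 : ∀ i a, ∑ s, ∑ t, algebraMap k Ω (B i s t) * (φ a (x s) * φ a (x t)) = 0 := by
    intro i a
    have := congrArg (φ a) (hBx i)
    simpa only [map_sum, map_mul, AlgHom.commutes, map_zero] using this
  have hp1 : ∀ i a (D : Derivation k Ω Ω),
      ∑ s, ∑ t, algebraMap k Ω (B i s t) * (φ a (x s) * D (φ a (x t))) = 0 := by
    intro i a D
    have h := congrArg D (hp0 i a)
    rw [hder, map_zero, add_comm, Finset.sum_comm] at h
    have h2 : ∑ t, ∑ s, algebraMap k Ω (B i s t) * (D (φ a (x s)) * φ a (x t)) =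
        ∑ s, ∑ t, algebraMap k Ω (B i s t) * (φ a (x s) * D (φ a (x t))) :=
      Finset.sum_congr rfl fun s _ => Finset.sum_congr rfl fun t _ => by
        rw [hsymm, mul_comm (D _)]
    rw [h2, ← two_mul] at h
    exact (mul_eq_zero.1 h).resolve_left two_ne_zero
  have hpa : ∀ a, q (fun s => φ a (x s)) = 0 := by
    intro a
    refine forall_eq_zero_of_span_eq_top
      (span_tangent_sup_generic_points_eq_top hx hi₀ ht hz hd a) ?_ ?_
    · rintro _ ⟨o, rfl⟩
      cases o with
      | none => exact hf a a
      | some l =>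
        rw [hq, combinedForm_apply]
        exact Finset.sum_eq_zero fun i _ => by
          simp only [Option.elim_some]
          rw [hp1, mul_zero]
    · rintro _ ⟨b, _, rfl⟩
      exact hf a b
  have hta : ∀ a l, q (fun s => d (a, l) (φ a (x s))) = 0 := by
    intro a l
    refine forall_eq_zero_of_span_eq_top
      (span_tangent_sup_generic_points_eq_top hx hi₀ ht hz hd a) ?_ ?_
    · rintro _ ⟨o, rfl⟩
      cases o with
      | none => rw [hqsymm]; exact LinearMap.congr_fun (hpa a) _
      | some m =>
        have h1 := LinearMap.congr_fun (hpa a) (fun s => d (a, l) (d (a, m) (φ a (x s))))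
        have h2 : q (fun s => φ a (x s)) (fun s => d (a, l) (d (a, m) (φ a (x s)))) +
            q (fun s => d (a, l) (φ a (x s))) (fun s => d (a, m) (φ a (x s))) = 0 := by
          rw [hq, combinedForm_apply, combinedForm_apply, ← Finset.sum_add_distrib]
          refine Finset.sum_eq_zero fun i _ => ?_
          have h := congrArg (d (a, l)) (hp1 i a (d (a, m)))
          rw [hder, map_zero] at h
          rw [← mul_add, h, mul_zero]
        rw [h1, LinearMap.zero_apply, zero_add] at h2
        exact h2
    · rintro _ ⟨b, _, rfl⟩
      rw [hqsymm]; exact LinearMap.congr_fun (hpa b) _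
  have hq0 : q = 0 := by
    refine LinearMap.ext fun w => LinearMap.ext fun v => ?_
    rw [hqsymm]
    refine LinearMap.congr_fun (f := q.flip w) (g := 0) ?_ v
    refine forall_eq_zero_of_span_eq_top
      (span_tangent_sup_generic_points_eq_top hx hi₀ ht hz hd i₀) ?_ ?_
    · rintro _ ⟨o, rfl⟩
      cases o with
      | none => exact LinearMap.congr_fun (hpa i₀) w
      | some l => exact LinearMap.congr_fun (hta i₀ l) w
    · rintro _ ⟨b, _, rfl⟩
      exact LinearMap.congr_fun (hpa b) w
  refine eq_zero_of_linearIndependent_of_sum_algebraMap hB fun st => ?_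
  have := LinearMap.congr_fun₂ hq0 (Pi.single st.1 1) (Pi.single st.2 1)
  rw [hq, combinedForm, Matrix.toBilin'_single] at this
  exact this

end GenericQuadrics

section GenericPackage

/-- Independent generic points `φ a`, one for each coordinate in `α`, span a linear space given
by a generic system of linear equations, with matrix `M`. -/
theorem exists_generic_matrix {k K : Type} [Field k] [IsAlgClosed k] [CharZero k] [Field K]
    [Algebra k K] {α β : Type} [Fintype α] [DecidableEq α] [Fintype β] [DecidableEq β]
    {x : α ⊕ β → K} (hx : LinearIndependent k x) {i₀ : α} (hi₀ : x (Sum.inl i₀) = 1)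
    (hz : IsTranscendenceBasis k (fun j => x (Sum.inr j))) :
    ∃ (Ω : Type) (_ : Field Ω) (_ : Algebra k Ω) (φ : α → K →ₐ[k] Ω) (M : α → β → Ω),
      (∀ a j, ∑ i, φ a (x (Sum.inl i)) * M i j = φ a (x (Sum.inr j))) ∧
      AlgebraicIndependent k (fun q : α × β => M q.1 q.2) ∧
      (∀ g : α → Ω, (∀ a, ∑ i, φ a (x (Sum.inl i)) * g i = 0) → g = 0) ∧
      ∀ (I : Type) [Fintype I] (B : I → α ⊕ β → α ⊕ β → k),
        LinearIndependent k (fun i => fun q : _ × _ => B i q.1 q.2) →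
        (∀ i s t, B i s t = B i t s) →
        (∀ i, ∑ s, ∑ t, algebraMap k K (B i s t) * (x s * x t) = 0) → ∀ f : I → Ω,
        (∀ a b, combinedForm B f (Sum.elim (Pi.single a 1) (M a))
          (Sum.elim (Pi.single b 1) (M b)) = 0) → f = 0 := by
  obtain ⟨Ω, iΩ, iA, φ, ht⟩ := exists_generic_points (α := α) hz
  have : CharZero Ω := charZero_of_injective_algebraMap (algebraMap k Ω).injective
  obtain ⟨d, hd⟩ := exists_isDual ht
  have hspan := span_generic_points_eq_top (x := x)
    (hx.comp Sum.inl Sum.inl_injective) ht hz hd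
  choose M hM using fun j => exists_linear_solution hspan (fun a => φ a (x (Sum.inr j)))
  refine ⟨Ω, iΩ, iA, φ, fun i j => M j i, fun a j => hM j a, ?_, ?_, ?_⟩
  · exact algebraicIndependent_matrix (M := fun i j => M j i) hx hi₀ ht hz hd (fun a j => hM j a)
  · intro g hg
    refine eq_zero_of_span_eq_top hspan ?_
    rintro _ ⟨a, rfl⟩
    exact hg a
  · intro I _ B hB hsymm hBx f hf
    refine eq_zero_of_combinedForm_generic_points hx hi₀ ht hz hd hB hsymm hBx fun a b => ?_
    have hp : ∀ a, (fun s => φ a (x s)) = ∑ i, φ a (x (Sum.inl i)) •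
        (Sum.elim (Pi.single i 1) (fun j => M j i) : α ⊕ β → Ω) := by
      intro a
      funext s
      cases s with
      | inl i => simp [Finset.sum_apply, Pi.single_apply]
      | inr j => simp [Finset.sum_apply, hM j a]
    rw [hp a, hp b]
    simp only [map_sum, map_smul, LinearMap.sum_apply, LinearMap.smul_apply, hf, smul_zero,
      Finset.sum_const_zero]

end GenericPackage

section GenericProjection

variable {k K : Type} [Field k] [Field K] [Algebra k K] {β γ : Type} [Fintype γ]

/-- The coefficients of a generic linear projection of the model with coordinates `x`: the
polynomial variables `u` and the equations `v` of the generic fibre. -/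
def projHom (x : Option γ ⊕ β → K) :
    MvPolynomial ((γ × β) ⊕ β) k →ₐ[k] MvPolynomial (γ × β) K :=
  aeval (Sum.elim X
    (fun j => C (x (Sum.inr j)) - ∑ i, C (x (Sum.inl (some i))) * X (i, j)))

/-- The matrix of the generic linear projection, over the polynomial ring of its coefficients. -/
def projMatrix (k : Type) [Field k] (γ β : Type) (a : Option γ) (j : β) :
    MvPolynomial ((γ × β) ⊕ β) k :=
  a.elim (X (Sum.inr j)) (fun i => X (Sum.inl (i, j)))

theorem sum_projHom_projMatrix (x : Option γ ⊕ β → K) (hx : x (Sum.inl none) = 1) (j : β) :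
    ∑ a, C (x (Sum.inl a)) * projHom (k := k) x (projMatrix k γ β a j) = C (x (Sum.inr j)) := by
  simp [Fintype.sum_option, projMatrix, projHom, hx]

theorem aevalTower_projHom {Ω : Type} [Field Ω] [Algebra k Ω] {x : Option γ ⊕ β → K}
    (hx : x (Sum.inl none) = 1)
    (φ : K →ₐ[k] Ω) {M : Option γ → β → Ω}
    (hM : ∀ j, ∑ a, φ (x (Sum.inl a)) * M a j = φ (x (Sum.inr j)))
    (f : MvPolynomial ((γ × β) ⊕ β) k) :
    aevalTower φ (fun q : γ × β => M (some q.1) q.2) (projHom x f) =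
      aeval (Sum.elim (fun q : γ × β => M (some q.1) q.2) (M none)) f := by
  have : (aevalTower φ (fun q : γ × β => M (some q.1) q.2)).comp (projHom x) =
      aeval (Sum.elim (fun q : γ × β => M (some q.1) q.2) (M none)) := by
    refine MvPolynomial.algHom_ext fun s => ?_
    cases s with
    | inl q => simp [projHom]
    | inr j =>
      have := hM j
      rw [Fintype.sum_option, hx, map_one, one_mul] at this
      simp [projHom, ← this]
  exact DFunLike.congr_fun this f

variable [IsAlgClosed k] [CharZero k] [DecidableEq γ] [Fintype β] [DecidableEq β]
  {x : Option γ ⊕ β → K}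

theorem exists_generic_aeval (hx : LinearIndependent k x) (hx1 : x (Sum.inl none) = 1)
    (hz : IsTranscendenceBasis k (fun j => x (Sum.inr j))) :
    ∃ (Ω : Type) (_ : Field Ω) (_ : Algebra k Ω)
      (ev : MvPolynomial ((γ × β) ⊕ β) k →ₐ[k] Ω), Function.Injective ev ∧
      (∀ f : Option γ → MvPolynomial ((γ × β) ⊕ β) k,
        ∑ a, C (x (Sum.inl a)) * projHom x (f a) = 0 → ∀ a, ev (f a) = 0) ∧
      (∀ f, projHom x f = 0 → ev f = 0) ∧
      ∀ (I : Type) [Fintype I] (B : I → Option γ ⊕ β → Option γ ⊕ β → k),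
        LinearIndependent k (fun i => fun q : _ × _ => B i q.1 q.2) →
        (∀ i s t, B i s t = B i t s) →
        (∀ i, ∑ s, ∑ t, algebraMap k K (B i s t) * (x s * x t) = 0) →
        ∀ f : I → MvPolynomial ((γ × β) ⊕ β) k,
        (∀ a b, ∑ i, f i * ∑ s, ∑ t, algebraMap k _ (B i s t) *
          ((Sum.elim (Pi.single a 1) (projMatrix k γ β a) : _ → MvPolynomial ((γ × β) ⊕ β) k) s *
          (Sum.elim (Pi.single b 1) (projMatrix k γ β b) : _ → MvPolynomial ((γ × β) ⊕ β) k) t) =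
            0) → ∀ i, ev (f i) = 0 := by
  obtain ⟨Ω, iΩ, iA, φ, M, hM, hMi, hM3, hM4⟩ := exists_generic_matrix hx hx1 hz
  refine ⟨Ω, iΩ, iA, aeval (Sum.elim (fun q : γ × β => M (some q.1) q.2) (M none)),
    ?_, ?_, ?_, ?_⟩
  · have h := hMi.comp (Sum.elim (fun q : γ × β => (some q.1, q.2)) (fun j => (none, j))) (by
      rintro (⟨i, j⟩ | j) (⟨i', j'⟩ | j') h
      · simpa using h
      · exact absurd (congrArg Prod.fst h) (Option.some_ne_none i)
      · exact absurd (congrArg Prod.fst h) (Option.some_ne_none i').symm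
      · exact congrArg Sum.inr (congrArg Prod.snd h))
    have e : (fun q : Option γ × β => M q.1 q.2) ∘
        Sum.elim (fun q : γ × β => (some q.1, q.2)) (fun j => (none, j)) =
        Sum.elim (fun q : γ × β => M (some q.1) q.2) (M none) := by
      funext s
      cases s <;> rfl
    rw [e] at h
    exact h
  · intro f hf
    refine fun a => congrFun (hM3 (fun a => aeval _ (f a)) fun b => ?_) a
    have := congrArg (aevalTower (φ b) (fun q : γ × β => M (some q.1) q.2)) hf
    simpa only [map_sum, map_mul, aevalTower_projHom hx1 (φ b) (hM b), aevalTower_C, map_zero]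
      using this
  · intro f hf
    rw [← aevalTower_projHom hx1 (φ none) (hM none), hf, map_zero]
  · intro I _ B hB hsymm hBx f hf
    refine fun i => congrFun (hM4 I B hB hsymm hBx (fun i => aeval _ (f i)) fun a b => ?_) i
    have h := congrArg (aeval (Sum.elim (fun q : γ × β => M (some q.1) q.2) (M none))) (hf a b)
    rw [map_zero] at h
    rw [combinedForm_apply, ← h]
    have hE : ∀ a s, aeval (Sum.elim (fun q : γ × β => M (some q.1) q.2) (M none))
        ((Sum.elim (Pi.single a 1) (projMatrix k γ β a) :
          _ → MvPolynomial ((γ × β) ⊕ β) k) s) = 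
        (Sum.elim (Pi.single a 1) (M a) : Option γ ⊕ β → Ω) s := by
      intro a s
      cases s with
      | inl b => 
        by_cases hb : b = a
        · subst hb; simp
        · simp [hb]
      | inr j => cases a <;> simp [projMatrix]
    simp only [map_sum, map_mul, AlgHom.commutes, hE]

end GenericProjection

section InitialForms

theorem eq_zero_of_sum_eval₂_mul_C {A K σ ι : Type} [CommRing A] [Field K] [Fintype ι]
    (h : A →+* MvPolynomial σ K) (e : ι → K)
    (he : ∀ p : ι → A, ∑ i, constantCoeff (h (p i)) * e i = 0 → ∀ i, p i = 0)
    (f : ι → MvPolynomial σ A) (hf : ∑ i, eval₂ h X (f i) * C (e i) = 0) (i : ι) : f i = 0 := by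
  suffices H : ∀ n, ∀ b : σ →₀ ℕ, b.degree = n → ∀ i, coeff b (f i) = 0 by
    ext b
    simpa using H _ b rfl i
  intro n
  induction n using Nat.strong_induction_on with
  | _ n ih =>
    intro b hb
    refine he (fun i => coeff b (f i)) ?_
    have h1 : ∀ i, coeff b (eval₂ h X (f i)) = constantCoeff (h (coeff b (f i))) := by
      intro i
      rw [eval₂_eq, coeff_sum]
      have key : ∀ a ∈ (f i).support, a ≠ b →
          coeff b (h (coeff a (f i)) * ∏ j ∈ a.support, (X j : MvPolynomial σ K) ^ a j) = 0 := by
        intro a ha hab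
        have hmon : ∏ j ∈ a.support, (X j : MvPolynomial σ K) ^ a j = monomial a 1 := by
          rw [monomial_eq, C_1, one_mul]; rfl
        rw [hmon, coeff_mul_monomial']
        split_ifs with hle
        · exfalso
          obtain ⟨c, rfl⟩ := exists_add_of_le hle
          have hc : c ≠ 0 := fun hc => hab (by simp [hc])
          have hd : a.degree < n := by
            have : c.degree ≠ 0 := fun h0 => hc (Finsupp.degree_eq_zero_iff c |>.1 h0)
            rw [← hb, map_add]
            omega
          exact (mem_support_iff.1 ha) (ih _ hd a rfl i)
        · rfl
      have hmon : ∏ j ∈ b.support, (X j : MvPolynomial σ K) ^ b j = monomial b 1 := by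
        rw [monomial_eq, C_1, one_mul]; rfl
      rw [Finset.sum_eq_single b key]
      · rw [hmon, coeff_mul_monomial', if_pos le_rfl, tsub_self, mul_one]
        rfl
      · intro hb'
        rw [notMem_support_iff.1 hb']
        simp
    have h2 := congrArg (coeff b) hf
    rw [coeff_sum] at h2
    simpa only [mul_comm _ (C _), coeff_C_mul, mul_comm _ (constantCoeff _), h1, coeff_zero]
      using h2

variable {k K : Type} [Field k] [Field K] [Algebra k K] {β γ : Type} [Fintype γ]

theorem eq_zero_of_sum_projHom_mul_C {x : Option γ ⊕ β → K} {ι : Type} [Fintype ι] (e : ι → K)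
    (he : ∀ p : ι → MvPolynomial β k,
      ∑ i, aeval (fun j => x (Sum.inr j)) (p i) * e i = 0 → ∀ i, p i = 0)
    (f : ι → MvPolynomial ((γ × β) ⊕ β) k) (hf : ∑ i, projHom x (f i) * C (e i) = 0) (i : ι) :
    f i = 0 := by
  let h : MvPolynomial β k →ₐ[k] MvPolynomial (γ × β) K :=
    aeval (fun j => C (x (Sum.inr j)) - ∑ i, C (x (Sum.inl (some i))) * X (i, j))
  have hc : ∀ p, constantCoeff (h p) = aeval (fun j => x (Sum.inr j)) p := by
    intro p
    have : (IsScalarTower.toAlgHom k K K).toRingHom.comp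
        (constantCoeff.comp (h : MvPolynomial β k →+* MvPolynomial (γ × β) K)) =
        (aeval (R := k) (fun j => x (Sum.inr j)) : MvPolynomial β k →+* K) := by
      refine MvPolynomial.ringHom_ext (fun r => ?_) fun j => ?_
      · simp [h, MvPolynomial.algebraMap_apply]
      · simp [h]
    exact DFunLike.congr_fun this p
  have hp : ∀ f, projHom x f = eval₂ (h : MvPolynomial β k →+* MvPolynomial (γ × β) K) X
      (sumAlgEquiv k (γ × β) β f) := by
    intro f
    have : (projHom (k := k) x : MvPolynomial ((γ × β) ⊕ β) k →+* MvPolynomial (γ × β) K) =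
        (eval₂Hom (h : MvPolynomial β k →+* MvPolynomial (γ × β) K) X).comp
        (sumAlgEquiv k (γ × β) β : _ →+* _) := by
      refine MvPolynomial.ringHom_ext (fun r => ?_) fun s => ?_
      · simp [h, projHom]
      · cases s <;> simp [h, projHom]
    exact DFunLike.congr_fun this f
  simp only [hp] at hf
  have := eq_zero_of_sum_eval₂_mul_C (h : MvPolynomial β k →+* MvPolynomial (γ × β) K) e
    (fun p hp0 => he p (by simpa only [RingHom.coe_coe, hc] using hp0)) _ hf i
  exact (map_eq_zero_iff _ (sumAlgEquiv k (γ × β) β).injective).1 this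

end InitialForms

section Conjugates

open TensorProduct

variable {k K Ω : Type} [Field k] [Field K] [Algebra k K] [Field Ω] [Algebra k Ω] {β γ : Type}

theorem isTranscendenceBasis_conjugates [CharZero Ω] [Fintype γ] [Fintype β] [DecidableEq γ]
    {y : γ → K} {z : β → K} (hz : IsTranscendenceBasis k z) {p q : K →ₐ[k] Ω} {u : γ × β → Ω}
    (ht : IsTranscendenceBasis k (Sum.elim u (fun j => p (z j))))
    (hv : ∀ j, p (z j) - q (z j) = ∑ i, u (i, j) * (p (y i) - q (y i)))
    {i₁ : γ} (hi : p (y i₁) ≠ q (y i₁)) :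
    IsTranscendenceBasis k (Sum.elim (Sum.elim (fun j => p (z j)) (fun j => q (z j)))
      (fun r : {i // i ≠ i₁} × β => u (r.1, r.2))) := by
  set t := Sum.elim (Sum.elim (fun j => p (z j)) (fun j => q (z j)))
      (fun r : {i // i ≠ i₁} × β => u (r.1, r.2)) with htdef
  have : Algebra.IsAlgebraic (Algebra.adjoin k (Set.range t)) Ω := by
    refine isAlgebraic_adjoin_of_forall_derivation _ fun D hD => ?_
    have hp : ∀ w, D (p w) = 0 := derivation_comp_eq_zero p hz D
      fun j => hD _ ⟨Sum.inl (Sum.inl j), rfl⟩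
    have hq : ∀ w, D (q w) = 0 := derivation_comp_eq_zero q hz D
      fun j => hD _ ⟨Sum.inl (Sum.inr j), rfl⟩
    have hu : ∀ i ≠ i₁, ∀ j, D (u (i, j)) = 0 := fun i hi j =>
      hD _ ⟨Sum.inr (⟨i, hi⟩, j), rfl⟩
    refine derivation_eq_zero ht D ?_
    rintro (⟨i, j⟩ | j)
    · by_cases h : i = i₁
      · subst h
        have h1 := congrArg D (hv j)
        rw [map_sub, hp, hq, map_sum, Finset.sum_eq_single i] at h1
        · simp only [Derivation.leibniz, map_sub, hp, hq, smul_eq_mul, sub_zero, mul_zero,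
            zero_add] at h1
          exact (mul_eq_zero.1 h1.symm).resolve_left (sub_ne_zero.2 hi)
        · intro b _ hb
          simp [Derivation.leibniz, hp, hq, hu b hb]
        · simp
      · exact hu i h j
    · exact hp _
  refine Algebra.IsAlgebraic.isTranscendenceBasis_of_le_trdeg_of_finite k t ?_
  rw [← ht.cardinalMk_eq_trdeg, Cardinal.mk_fintype, Cardinal.mk_fintype]
  have h1 : 0 < Fintype.card γ := Fintype.card_pos_iff.2 ⟨i₁⟩
  simp only [Fintype.card_sum, Fintype.card_prod, Fintype.card_subtype_compl,
    Fintype.card_unique, ne_eq]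
  norm_cast
  obtain ⟨m, hm⟩ : ∃ m, Fintype.card γ = m + 1 := ⟨_, (Nat.succ_pred_eq_of_pos h1).symm⟩
  rw [hm, Nat.add_sub_cancel]
  apply le_of_eq
  ring

theorem derivation_aevalTower_eq_zero {τ : Type} (D : Derivation k Ω Ω) (p : K →ₐ[k] Ω)
    (u : τ → Ω) (hp : ∀ w, D (p w) = 0) (hu : ∀ i, D (u i) = 0) (f : MvPolynomial τ K) :
    D (aevalTower p u f) = 0 := by
  induction f using MvPolynomial.induction_on with
  | C a => simp [hp]
  | add f g hf hg => simp [hf, hg]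
  | mul_X f i hf => simp [hf, hu]

variable [IsAlgClosed k] [CharZero Ω] [Fintype γ] [Fintype β] [DecidableEq γ] [DecidableEq β]
  {y : γ → K} {z : β → K} {p q : K →ₐ[k] Ω} {u : γ × β → Ω}

theorem lift_aevalTower_injective (hz : IsTranscendenceBasis k z)
    (ht : IsTranscendenceBasis k (Sum.elim u (fun j => p (z j))))
    (hu : Function.Injective (aevalTower p u))
    (hv : ∀ j, p (z j) - q (z j) = ∑ i, u (i, j) * (p (y i) - q (y i)))
    {i₁ : γ} (hi : p (y i₁) ≠ q (y i₁)) :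
    Function.Injective (Algebra.TensorProduct.lift q
      (aevalTower p fun r : {i // i ≠ i₁} × β => u (r.1, r.2)) fun _ _ => Commute.all _ _) := by
  classical
  have ht' := isTranscendenceBasis_conjugates hz ht hv hi
  obtain ⟨d, hd⟩ := exists_isDual ht'
  have hu' : Function.Injective (aevalTower p fun r : {i // i ≠ i₁} × β => u (r.1, r.2)) := by
    have h1 : aevalTower p (fun r : {i // i ≠ i₁} × β => u (r.1, r.2)) =
        (aevalTower p u).comp ((rename (R := K)
          (fun r : {i // i ≠ i₁} × β => ((r.1 : γ), r.2))).restrictScalars k) := by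
      ext <;> simp
    rw [h1]
    refine hu.comp (rename_injective _ ?_)
    rintro ⟨⟨a, _⟩, b⟩ ⟨⟨a', _⟩, b'⟩ h
    simpa using h
  rw [injective_iff_map_eq_zero]
  intro a ha
  let ℬ := Module.Basis.ofVectorSpace k K
  obtain ⟨c, rfl⟩ := (TensorProduct.equivFinsuppOfBasisLeft ℬ).symm.surjective a
  rw [TensorProduct.equivFinsuppOfBasisLeft_symm_apply] at ha ⊢
  rw [Finsupp.sum, map_sum] at ha
  simp only [Algebra.TensorProduct.lift_tmul] at ha
  have key := hd.eq_zero_of_sum_mul_eq_zero ht' (x := fun s => q (ℬ s))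
    (ℬ.linearIndependent.map' q.toLinearMap (LinearMap.ker_eq_bot.2 q.injective))
    (Set.range (fun j => Sum.inl (Sum.inr j))) ?_ c.support
    (fun s => aevalTower p (fun r : {i // i ≠ i₁} × β => u (r.1, r.2)) (c s)) ?_
    (by simpa only [mul_comm] using ha)
  · refine Finset.sum_eq_zero fun s hs => ?_
    have h0 := (map_eq_zero_iff _ hu').1 (key s hs)
    exact absurd h0 (Finsupp.mem_support_iff.1 hs)
  · intro i hi s
    refine derivation_comp_eq_zero q hz (d i) (fun j => ?_) _
    have := hd i (Sum.inl (Sum.inr j))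
    rw [if_neg] at this
    · exact this
    · rintro rfl
      exact hi ⟨j, rfl⟩
  · rintro _ ⟨j, rfl⟩ s _
    refine derivation_aevalTower_eq_zero _ _ _
      (derivation_comp_eq_zero p hz _ fun j' => ?_) (fun r => ?_) _
    · have := hd (Sum.inl (Sum.inr j)) (Sum.inl (Sum.inl j'))
      simpa using this
    · have := hd (Sum.inl (Sum.inr j)) (Sum.inr r)
      simpa using this

end Conjugates

section Universality

open TensorProduct

variable {k K Ω : Type} [Field k] [Field K] [Algebra k K] [Field Ω] [Algebra k Ω] {β γ : Type}
  [IsAlgClosed k] [CharZero Ω] [Fintype γ] [Fintype β] [DecidableEq γ] [DecidableEq β]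
  {y : γ → K} {z : β → K} {p : K →ₐ[k] Ω} {u : γ × β → Ω}

theorem exists_injective_factor (hz : IsTranscendenceBasis k z)
    (ht : IsTranscendenceBasis k (Sum.elim u (fun j => p (z j))))
    (hu : Function.Injective (aevalTower p u)) (i₁ : γ) :
    ∃ (T : Type) (_ : CommRing T) (_ : Algebra k T)
      (ρ : K ⊗[k] MvPolynomial (γ × β) K →ₐ[k] T), ∀ q : K →ₐ[k] Ω,
      (∀ j, p (z j) - q (z j) = ∑ i, u (i, j) * (p (y i) - q (y i))) →
      p (y i₁) ≠ q (y i₁) → ∃ φ : T →ₐ[k] Ω, Function.Injective φ ∧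
        φ.comp ρ = Algebra.TensorProduct.lift q (aevalTower p u) fun _ _ => Commute.all _ _ := by
  let R' := MvPolynomial ({i // i ≠ i₁} × β) K
  let A := K ⊗[k] R'
  let Δ : K → A := fun w => 1 ⊗ₜ[k] (C w : R') - w ⊗ₜ[k] (1 : R')
  let T := Localization.Away (Δ (y i₁))
  let κ : A →ₐ[k] T := Algebra.algHom k A T
  let ρ : K ⊗[k] MvPolynomial (γ × β) K →ₐ[k] T := Algebra.TensorProduct.lift
    (κ.comp Algebra.TensorProduct.includeLeft)
    (aevalTower (κ.comp ((Algebra.TensorProduct.includeRight).comp (Algebra.algHom k K R')))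
      (fun r => if h : r.1 ≠ i₁ then κ (1 ⊗ₜ[k] (X (⟨r.1, h⟩, r.2) : R')) else
        κ (Δ (z r.2) - ∑ i : {i // i ≠ i₁}, 1 ⊗ₜ[k] (X (i, r.2) : R') * Δ (y i)) *
          IsLocalization.Away.invSelf (Δ (y i₁)))) fun _ _ => Commute.all _ _
  refine ⟨T, inferInstance, inferInstance, ρ, fun q hv hi => ?_⟩
  let π : A →ₐ[k] Ω := Algebra.TensorProduct.lift q
      (aevalTower p fun r : {i // i ≠ i₁} × β => u (r.1, r.2)) fun _ _ => Commute.all _ _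
  have hπ : Function.Injective π := lift_aevalTower_injective hz ht hu hv hi
  have hπt : ∀ w f, π (w ⊗ₜ[k] f) = q w * aevalTower p (fun r : {i // i ≠ i₁} × β =>
      u (r.1, r.2)) f := fun w f => Algebra.TensorProduct.lift_tmul _ _ _ _ _
  have hπΔ : ∀ w, π (Δ w) = p w - q w := fun w => by
    simp only [Δ, map_sub, hπt, map_one, one_mul, mul_one, aevalTower_C]
  have hunit : ∀ s : Submonoid.powers (Δ (y i₁)), IsUnit (π s) := by
    rintro ⟨_, m, rfl⟩
    simp only [map_pow, hπΔ]
    exact ((sub_ne_zero.2 hi).isUnit).pow _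
  let φ : T →ₐ[k] Ω := IsLocalization.liftAlgHom (M := Submonoid.powers (Δ (y i₁))) (f := π) hunit
  have hφκ : ∀ a, φ (κ a) = π a := fun a => IsLocalization.lift_eq hunit a
  have hφinv : φ (IsLocalization.Away.invSelf (Δ (y i₁))) = (p (y i₁) - q (y i₁))⁻¹ := by
    have h1 : κ (Δ (y i₁)) * IsLocalization.Away.invSelf (Δ (y i₁)) = 1 :=
      IsLocalization.Away.mul_invSelf _
    have := congrArg φ h1
    rw [map_mul, hφκ, hπΔ, map_one] at this
    exact eq_inv_of_mul_eq_one_right this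
  refine ⟨φ, ?_, ?_⟩
  · rw [injective_iff_map_eq_zero]
    intro a ha
    obtain ⟨b, s, rfl⟩ := IsLocalization.exists_mk'_eq (Submonoid.powers (Δ (y i₁))) a
    have : φ (algebraMap A T b) = 0 := by
      rw [← IsLocalization.mk'_spec T b s, map_mul, ha, zero_mul]
    have hb : b = 0 := hπ (by rw [map_zero]; exact (hφκ b).symm.trans this)
    rw [hb, IsLocalization.mk'_zero]
  · have hρl : ∀ w, ρ (w ⊗ₜ[k] 1) = κ (w ⊗ₜ[k] 1) := fun w => by
      rw [Algebra.TensorProduct.lift_tmul, map_one, mul_one]; rfl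
    have hρC : ∀ w, ρ (1 ⊗ₜ[k] C w) = κ (1 ⊗ₜ[k] (C w : R')) := fun w => by
      rw [Algebra.TensorProduct.lift_tmul, map_one, one_mul, aevalTower_C]; rfl
    refine Algebra.TensorProduct.ext ?_ ?_
    · ext w
      change φ (ρ (w ⊗ₜ[k] 1)) = _
      simp [hρl, hφκ, hπt]
    · ext r
      · change φ (ρ (1 ⊗ₜ[k] C r)) = _
        simp [hρC, hφκ, hπt]
      · obtain ⟨i, j⟩ := r
        change φ (ρ (1 ⊗ₜ[k] X (i, j))) = Algebra.TensorProduct.lift q (aevalTower p u)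
          (fun _ _ => Commute.all _ _) (1 ⊗ₜ[k] X (i, j))
        rw [Algebra.TensorProduct.lift_tmul, Algebra.TensorProduct.lift_tmul, map_one, map_one,
          one_mul, one_mul, aevalTower_X, aevalTower_X]
        by_cases h : i ≠ i₁
        · rw [dif_pos h, hφκ, hπt, map_one, one_mul, aevalTower_X]
        · rw [dif_neg h, map_mul, hφκ, hφinv, map_sub, hπΔ, hv, map_sum]
          simp only [map_mul, hπt, map_one, one_mul, aevalTower_X, hπΔ]
          rw [not_not] at h
          subst h
          rw [mul_inv_eq_iff_eq_mul₀ (sub_ne_zero.2 hi),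
            Fintype.sum_eq_add_sum_subtype_ne _ i, add_sub_cancel_right]

end Universality

section Primitivity

open TensorProduct

variable {k K : Type} [Field k] [Field K] [Algebra k K] {β γ : Type}
  [IsAlgClosed k] [Fintype γ] [Fintype β] [DecidableEq γ] [DecidableEq β]
  {y : γ → K} {z : β → K}

theorem apply_ne_apply_of_ne {Ω : Type} [Field Ω] [Algebra k Ω] [CharZero Ω]
    {p q : K →ₐ[k] Ω} {u : γ × β → Ω} (hz : IsTranscendenceBasis k z)
    (ht : IsTranscendenceBasis k (Sum.elim u (fun j => p (z j))))
    (hu : Function.Injective (aevalTower p u))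
    (hgen : IntermediateField.adjoin k (Set.range (Sum.elim y z)) = ⊤)
    (hv : ∀ j, p (z j) - q (z j) = ∑ i, u (i, j) * (p (y i) - q (y i)))
    (hpq : q ≠ p) {i : γ} (hi : y i ∉ Submodule.span k {(1 : K)}) : p (y i) ≠ q (y i) := by
  obtain ⟨i₁, hi₁⟩ : ∃ i₁, p (y i₁) ≠ q (y i₁) := by
    by_contra! h
    have key : ∀ w ∈ IntermediateField.adjoin k (Set.range (Sum.elim y z)), q w = p w := by
      intro w hw
      have hle : IntermediateField.adjoin k (Set.range (Sum.elim y z)) ≤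
          IntermediateField.mk (AlgHom.equalizer q p) (fun w hw => by
            simp_all) := IntermediateField.adjoin_le_iff.2 ?_
      · exact hle hw
      rintro _ ⟨i | j, rfl⟩
      · exact (h i).symm
      · have := hv j
        simp only [h, sub_self, mul_zero, Finset.sum_const_zero] at this
        exact (sub_eq_zero.1 this).symm
    exact hpq (AlgHom.ext fun w => key w (hgen ▸ IntermediateField.mem_top))
  intro h
  have h1 := lift_aevalTower_injective hz ht hu hv hi₁
    (a₁ := y i ⊗ₜ[k] 1) (a₂ := 1 ⊗ₜ[k] C (y i)) (by simp [h])
  obtain ⟨f, hf, hf1⟩ := Submodule.exists_dual_map_eq_bot_of_notMem hi inferInstance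
  have hf1' : f 1 = 0 := by
    have := Submodule.mem_map_of_mem (f := f) (Submodule.mem_span_singleton_self (R := k) (1 : K))
    rwa [hf1, Submodule.mem_bot] at this
  have h2 := congrArg (fun a => TensorProduct.lid k _ (f.rTensor _ a)) h1
  simp only [LinearMap.rTensor_tmul, TensorProduct.lid_tmul, hf1', zero_smul,
    smul_eq_zero, one_ne_zero, or_false] at h2
  exact hf h2

variable {F L : Type} [Field F] [Field L] [Algebra F L] [FiniteDimensional F L]
  [Algebra k F] [Algebra k L] [IsScalarTower k F L] [CharZero k]
  [Algebra (MvPolynomial (γ × β) K) L] [IsFractionRing (MvPolynomial (γ × β) K) L]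
  [IsScalarTower k (MvPolynomial (γ × β) K) L]

theorem intermediateField_eq_bot_or_eq_top [Nonempty γ] (hz : IsTranscendenceBasis k z)
    (hgen : IntermediateField.adjoin k (Set.range (Sum.elim y z)) = ⊤)
    (hy : ∀ i, y i ∉ Submodule.span k {(1 : K)})
    (hX : ∀ r, algebraMap (MvPolynomial (γ × β) K) L (X r) ∈ Set.range (algebraMap F L))
    (hF : ∀ j, algebraMap (MvPolynomial (γ × β) K) L (C (z j) - ∑ i, C (y i) * X (i, j)) ∈
      Set.range (algebraMap F L)) (E : IntermediateField F L) : E = ⊥ ∨ E = ⊤ := by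
  classical
  let R := MvPolynomial (γ × β) K
  let Ω := AlgebraicClosure L
  have hch : CharZero Ω := charZero_of_injective_algebraMap (algebraMap k Ω).injective
  have hchF : CharZero F := charZero_of_injective_algebraMap (algebraMap k F).injective
  let ι : L →ₐ[F] Ω := IsScalarTower.toAlgHom F L Ω
  let q : (L →ₐ[F] Ω) → K →ₐ[k] Ω := fun σ => (σ.restrictScalars k).comp
    ((IsScalarTower.toAlgHom k R L).comp (Algebra.algHom k K R))
  have hq : ∀ σ w, q σ w = σ (algebraMap R L (C w)) := fun σ w => rfl
  let p := q ι
  let u : γ × β → Ω := fun r => ι (algebraMap R L (X r))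
  have hσX : ∀ (σ : L →ₐ[F] Ω) r, σ (algebraMap R L (X r)) = u r := by
    intro σ r
    obtain ⟨f, hf⟩ := hX r
    simp only [u, R, ← hf, AlgHom.commutes]
  have hpu : ∀ f, aevalTower p u f = ι (algebraMap R L f) := by
    intro f
    have : aevalTower p u = (ι.restrictScalars k).comp (IsScalarTower.toAlgHom k R L) := by
      ext w <;> simp [p, u, hq, R]
    rw [this]; rfl
  have hu : Function.Injective (aevalTower p u) := by
    intro f g hfg
    rw [hpu, hpu] at hfg
    exact IsFractionRing.injective R L (ι.injective hfg)
  have ht : IsTranscendenceBasis k (Sum.elim u (fun j => p (z j))) := by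
    have h1 := (hz.sumElim_comp (IsTranscendenceBasis.mvPolynomial (γ × β) K))
    have : Algebra.IsAlgebraic R L := 
      (IsFractionRing.comap_isAlgebraic_iff (A := R) (K := L) (C := L)).2 inferInstance
    have : FaithfulSMul R L :=
      (faithfulSMul_iff_algebraMap_injective R L).2 (IsFractionRing.injective R L)
    have h2 := h1.algebraMap_comp (A := L)
    have h3 := h2.algebraMap_comp (A := Ω)
    convert! h3 using 1
    funext s
    cases s <;> rfl
  have hv : ∀ σ j, p (z j) - q σ (z j) = ∑ i, u (i, j) * (p (y i) - q σ (y i)) := by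
    intro σ j
    have hσ : ∀ τ : L →ₐ[F] Ω, q τ (z j) - ∑ i, u (i, j) * q τ (y i) =
        τ (algebraMap R L (C (z j) - ∑ i, C (y i) * X (i, j))) := by
      intro τ
      simp only [map_sub, map_sum, map_mul]
      simp only [hq, ← hσX τ, mul_comm]
    obtain ⟨f, hf⟩ := hF j
    have h := (hσ ι).trans (((congrArg ι hf).symm.trans ((ι.commutes f).trans
      (σ.commutes f).symm)).trans ((congrArg σ hf).trans (hσ σ).symm))
    simp only [mul_sub, Finset.sum_sub_distrib]
    linear_combination h
  have hne : ∀ σ, σ ≠ ι → q σ ≠ p := by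
    intro σ hσ h
    apply hσ
    have : (σ : L →+* Ω).comp (algebraMap R L) = (ι : L →+* Ω).comp (algebraMap R L) := by
      refine MvPolynomial.ringHom_ext (fun w => ?_) fun r => ?_
      · exact DFunLike.congr_fun h w
      · exact (hσX σ r).trans (hσX ι r).symm
    have h2 := IsLocalization.ringHom_ext (nonZeroDivisors R) this
    exact AlgHom.ext fun a => DFunLike.congr_fun h2 a
  obtain ⟨i₁⟩ := ‹Nonempty γ›
  obtain ⟨T, iT, iA, ρ, hρ⟩ := exists_injective_factor (y := y) hz ht hu i₁
  have hfix : ∀ σ τ, σ ≠ ι → τ ≠ ι → ∀ e, σ e = ι e → τ e = ι e := by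
    intro σ τ hσ hτ e he
    obtain ⟨b, b', hb', rfl⟩ := IsFractionRing.div_surjective (A := R) e
    have hb0 : algebraMap R L b' ≠ 0 := IsFractionRing.to_map_ne_zero_of_mem_nonZeroDivisors hb'
    let S : R →ₐ[k] K ⊗[k] R := aevalTower Algebra.TensorProduct.includeLeft
      fun r => 1 ⊗ₜ[k] (X r : R)
    let π : (L →ₐ[F] Ω) → K ⊗[k] R →ₐ[k] Ω := fun σ =>
      Algebra.TensorProduct.lift (q σ) (aevalTower p u) fun _ _ => Commute.all _ _
    have hπS : ∀ σ f, π σ (S f) = σ (algebraMap R L f) := by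
      intro σ f
      have : (π σ).comp S = (σ.restrictScalars k).comp (IsScalarTower.toAlgHom k R L) := by
        ext w
        · change π σ (S (C w)) = σ (algebraMap R L (C w))
          have hS : S (C w) = w ⊗ₜ[k] 1 := aevalTower_C _ _ _
          rw [hS, Algebra.TensorProduct.lift_tmul, map_one, mul_one, hq]
        · change π σ (S (X w)) = σ (algebraMap R L (X w))
          have hS : S (X w) = 1 ⊗ₜ[k] (X w : R) := aevalTower_X _ _ _
          rw [hS, Algebra.TensorProduct.lift_tmul, map_one, one_mul, aevalTower_X, hσX]
      exact DFunLike.congr_fun this f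
    have hπ1 : ∀ σ f, π σ (1 ⊗ₜ[k] f) = ι (algebraMap R L f) := by
      intro σ f
      simp only [π, Algebra.TensorProduct.lift_tmul, map_one, one_mul, hpu]
    let a : K ⊗[k] R := S b * 1 ⊗ₜ[k] b' - 1 ⊗ₜ[k] b * S b'
    have ha : ∀ σ, π σ a = 0 ↔ σ (algebraMap R L b / algebraMap R L b') =
        ι (algebraMap R L b / algebraMap R L b') := by
      intro σ
      have h1 : σ (algebraMap R L b') ≠ 0 := (map_ne_zero σ).2 hb0
      have h2 : ι (algebraMap R L b') ≠ 0 := (map_ne_zero ι).2 hb0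
      rw [map_div₀, map_div₀, div_eq_div_iff h1 h2]
      simp only [a, map_sub, map_mul, hπS, hπ1, sub_eq_zero]
    have hchar : ∀ σ, σ ≠ ι → (π σ a = 0 ↔ ρ a = 0) := by
      intro σ hσ
      obtain ⟨φ, hφ, hφρ⟩ := hρ (q σ) (hv σ)
        (apply_ne_apply_of_ne hz ht hu hgen (hv σ) (hne σ hσ) (hy i₁))
      have : π σ a = φ (ρ a) := (DFunLike.congr_fun hφρ a).symm
      rw [this, map_eq_zero_iff φ hφ]
    exact (ha τ).1 ((hchar τ hτ).2 ((hchar σ hσ).1 ((ha σ).2 he)))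
  by_cases hE : E = ⊤
  · exact Or.inr hE
  refine Or.inl ?_
  obtain ⟨σ, hσ, hσE⟩ : ∃ σ : L →ₐ[F] Ω, σ ≠ ι ∧ ∀ e ∈ E, σ e = ι e := by
    have hcard := AlgHom.card E L Ω
    have h1 : 1 < Fintype.card (L →ₐ[E] Ω) := by
      rw [hcard]
      by_contra! h
      have h2 : Module.finrank E L = 1 := le_antisymm h Module.finrank_pos
      exact hE (IntermediateField.finrank_eq_one_iff_eq_top.1 h2)
    obtain ⟨σ, hσ⟩ := Fintype.exists_ne_of_one_lt_card h1 (IsScalarTower.toAlgHom E L Ω)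
    refine ⟨σ.restrictScalars F, fun h => hσ (AlgHom.ext fun a => DFunLike.congr_fun h a),
      fun e he => σ.commutes ⟨e, he⟩⟩
  have hall : ∀ τ : L →ₐ[F] Ω, ∀ e ∈ E, τ e = ι e := by
    intro τ e he
    by_cases hτ : τ = ι
    · rw [hτ]
    · exact hfix σ τ hσ hτ e (hσE e he)
  rw [← IntermediateField.finrank_eq_one_iff, ← AlgHom.card F E Ω, Fintype.card_eq_one_iff]
  refine ⟨ι.comp E.val, fun τ => ?_⟩
  obtain ⟨τ', rfl⟩ := IsAlgClosed.surjective_domRestrict_of_isAlgebraic (E := L) τ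
  exact AlgHom.ext fun e => hall τ' e e.2

end Primitivity

section Counting

variable {F L α I : Type} [Field F] [CharZero F] [Field L] [Algebra F L] [Fintype α]
  [DecidableEq α] [Fintype I]

theorem card_add_finrank_span_mul_span_le (Y : α → L) (Q : I → Sym2 α → F)
    (hQ : LinearIndependent F Q) (h : ∀ i, ∑ a, ∑ b, Q i s(a, b) • (Y a * Y b) = 0) :
    Fintype.card I + Module.finrank F (Submodule.span F (Set.range Y) *
      Submodule.span F (Set.range Y) : Submodule F L) ≤ (Fintype.card α + 1).choose 2 := by
  let Ψ : (Sym2 α → F) →ₗ[F] L :=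
    ∑ a, ∑ b, (LinearMap.proj (s(a, b) : Sym2 α) : (Sym2 α → F) →ₗ[F] F).smulRight (Y a * Y b)
  have hΨ : ∀ g, Ψ g = ∑ a, ∑ b, g s(a, b) • (Y a * Y b) := fun g => by
    simp [Ψ, LinearMap.sum_apply]
  have h1 : Submodule.span F (Set.range Y) * Submodule.span F (Set.range Y) ≤
      LinearMap.range Ψ := by
    rw [Submodule.span_mul_span, Submodule.span_le]
    rintro _ ⟨_, ⟨a, rfl⟩, _, ⟨b, rfl⟩, rfl⟩
    let N : ℕ := (Finset.univ.filter fun r : α × α => s(r.1, r.2) = s(a, b)).card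
    have hN : (N : F) ≠ 0 := by
      rw [Nat.cast_ne_zero]
      exact Finset.card_ne_zero.2 ⟨(a, b), by simp⟩
    have h2 : Ψ (Pi.single s(a, b) 1) = (N : F) • (Y a * Y b) := by
      rw [hΨ, ← Fintype.sum_prod_type' (f := fun c d =>
        (Pi.single s(a, b) 1 : Sym2 α → F) s(c, d) • (Y c * Y d))]
      have : ∀ r : α × α, (Pi.single s(a, b) 1 : Sym2 α → F) s(r.1, r.2) • (Y r.1 * Y r.2) =
          if s(r.1, r.2) = s(a, b) then Y a * Y b else 0 := by
        rintro ⟨c, d⟩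
        split_ifs with h
        · rw [Pi.single_apply, if_pos h, one_smul]
          rcases Sym2.eq_iff.1 h with ⟨rfl, rfl⟩ | ⟨rfl, rfl⟩
          · rfl
          · exact mul_comm _ _
        · rw [Pi.single_apply, if_neg h, zero_smul]
      rw [Finset.sum_congr rfl fun r _ => this r, ← Finset.sum_filter, Finset.sum_const,
        Nat.cast_smul_eq_nsmul]
    refine ⟨(N : F)⁻¹ • Pi.single s(a, b) 1, ?_⟩
    rw [map_smul, h2, inv_smul_smul₀ hN]
  have h3 := LinearMap.finrank_range_add_finrank_ker Ψ
  rw [Module.finrank_fintype_fun_eq_card, Sym2.card] at h3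
  have h4 : Fintype.card I ≤ Module.finrank F (LinearMap.ker Ψ) := by
    let Q' : I → LinearMap.ker Ψ := fun i => ⟨Q i, by rw [LinearMap.mem_ker, hΨ, h]⟩
    have : LinearIndependent F Q' := LinearIndependent.of_comp (LinearMap.ker Ψ).subtype hQ
    exact this.fintype_card_le_finrank
  have h5 := Submodule.finrank_mono h1
  lia

end Counting

section Assembly

variable {k K : Type} [Field k] [Field K] [Algebra k K] {β γ : Type} [Fintype γ]
  [IsAlgClosed k] [CharZero k] [DecidableEq γ] [Fintype β] [DecidableEq β]
  {x : Option γ ⊕ β → K}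

theorem finiteDimensional_of_projHom {F L : Type} [Field F] [Field L] [Algebra F L]
    [Algebra (MvPolynomial ((γ × β) ⊕ β) k) F]
    [Algebra (MvPolynomial ((γ × β) ⊕ β) k) L] [IsScalarTower (MvPolynomial ((γ × β) ⊕ β) k) F L]
    [Algebra (MvPolynomial (γ × β) K) L] [IsFractionRing (MvPolynomial (γ × β) K) L]
    [Algebra k F] [Algebra k L] [IsScalarTower k F L]
    [IsScalarTower k (MvPolynomial (γ × β) K) L]
    (hFL : ∀ f, algebraMap (MvPolynomial ((γ × β) ⊕ β) k) L f =
      algebraMap (MvPolynomial (γ × β) K) L (projHom x f))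
    (hinj : Function.Injective (projHom (k := k) x))
    (hz : IsTranscendenceBasis k (fun j => x (Sum.inr j)))
    (hgen : IntermediateField.adjoin k (Set.range x) = ⊤) : FiniteDimensional F L := by
  let P := MvPolynomial ((γ × β) ⊕ β) k
  let R := MvPolynomial (γ × β) K
  have : Algebra.IsAlgebraic R L :=
    (IsFractionRing.comap_isAlgebraic_iff (A := R) (K := L) (C := L)).2 inferInstance
  have : FaithfulSMul R L :=
    (faithfulSMul_iff_algebraMap_injective R L).2 (IsFractionRing.injective R L)
  have htb := (hz.sumElim_comp (IsTranscendenceBasis.mvPolynomial (γ × β) K)).algebraMap_comp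
    (A := L)
  let t : (γ × β) ⊕ β → L := fun s => algebraMap P L (X s)
  let h : P →ₐ[k] L := (IsScalarTower.toAlgHom k R L).comp (projHom x)
  have hh : ∀ f, h f = algebraMap P L f := fun f => (hFL f).symm
  have ht : AlgebraicIndependent k t := by
    have : aeval t = h := by
      refine MvPolynomial.algHom_ext fun s => ?_
      rw [aeval_X, hh]
    rw [AlgebraicIndependent, this]
    exact (IsFractionRing.injective R L).comp hinj
  have ht' : IsTranscendenceBasis k t :=
    ht.isTranscendenceBasis_of_trdeg_le_of_finite htb.cardinalMk_eq_trdeg.ge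
  have hmem : ∀ f : P, algebraMap P L f ∈ Set.range (algebraMap F L) := fun f =>
    ⟨algebraMap P F f, (IsScalarTower.algebraMap_apply P F L f).symm⟩
  have halg : Algebra.IsAlgebraic F L := by
    have h1 := ht'.isAlgebraic
    constructor
    intro a
    have h2 : Algebra.adjoin k (Set.range t) ≤ (IsScalarTower.toAlgHom k F L).range := by
      refine Algebra.adjoin_le ?_
      rintro _ ⟨s, rfl⟩
      exact hmem _
    let e := AlgEquiv.ofInjective (IsScalarTower.toAlgHom k F L) (algebraMap F L).injective
    let j : Algebra.adjoin k (Set.range t) →ₐ[k] F :=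
      (e.symm : _ →ₐ[k] F).comp (Subalgebra.inclusion h2)
    have hj : ∀ b, algebraMap F L (j b) = b := fun b =>
      congrArg Subtype.val (e.apply_symm_apply (Subalgebra.inclusion h2 b))
    refine (h1.isAlgebraic a).ringHom_of_comp_eq j (RingHom.id L) (fun b b' hb => ?_)
      (RingHom.ext hj)
    exact Subtype.ext (by rw [← hj, ← hj b', hb])
  let S : Set L := Set.range fun s => algebraMap R L (C (x s))
  have hS : Finite S := inferInstance
  have htop : IntermediateField.adjoin F S = ⊤ := by
    rw [eq_top_iff]
    have hK : ∀ w : K, algebraMap R L (C w) ∈ IntermediateField.adjoin F S := by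
      intro w
      let i : K →ₐ[k] L := (IsScalarTower.toAlgHom k R L).comp (Algebra.algHom k K R)
      have hle : IntermediateField.adjoin k (Set.range x) ≤
          ((IntermediateField.adjoin F S).restrictScalars k).comap i := by
        refine IntermediateField.adjoin_le_iff.2 ?_
        rintro _ ⟨s, rfl⟩
        exact IntermediateField.subset_adjoin F S ⟨s, rfl⟩
      rw [hgen] at hle
      exact hle IntermediateField.mem_top
    have hR : ∀ f : R, algebraMap R L f ∈ IntermediateField.adjoin F S := by
      intro f
      induction f using MvPolynomial.induction_on with
      | C a => exact hK a
      | add f g hf hg => rw [map_add]; exact add_mem hf hg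
      | mul_X f r hf =>
        rw [map_mul]
        refine mul_mem hf ?_
        have h1 : algebraMap R L (X r) = algebraMap P L (X (Sum.inl r)) := by
          rw [hFL, projHom, aeval_X]; rfl
        obtain ⟨b, hb⟩ := hmem (X (Sum.inl r))
        rw [h1, ← hb]
        exact (IntermediateField.adjoin F S).algebraMap_mem b
    intro a _
    obtain ⟨b, b', _, rfl⟩ := IsFractionRing.div_surjective (A := R) a
    exact div_mem (hR b) (hR b')
  have h3 := IntermediateField.finiteDimensional_adjoin (K := F) (S := S)
    fun a _ => (halg.isAlgebraic a).isIntegral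
  rw [htop] at h3
  exact Module.Finite.of_surjective (IntermediateField.topEquiv (F := F) (E := L)).toLinearMap
    (IntermediateField.topEquiv (F := F) (E := L)).surjective

end Assembly

section FieldBound

variable {k K : Type} [Field k] [Field K] [Algebra k K] {β γ : Type} [Fintype γ]
  [IsAlgClosed k] [CharZero k] [DecidableEq γ] [Fintype β] [DecidableEq β]
  {x : Option γ ⊕ β → K}

theorem sum_comm_four {M σ τ : Type} [AddCommMonoid M] [Fintype σ] [Fintype τ]
    (f : σ → σ → τ → τ → M) :
    ∑ a, ∑ b, ∑ s, ∑ t, f a b s t = ∑ s, ∑ t, ∑ a, ∑ b, f a b s t := by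
  calc
    _ = ∑ a, ∑ s, ∑ b, ∑ t, f a b s t := Finset.sum_congr rfl fun a _ => Finset.sum_comm
    _ = ∑ s, ∑ a, ∑ t, ∑ b, f a b s t := Finset.sum_comm.trans
      (Finset.sum_congr rfl fun s _ => Finset.sum_congr rfl fun a _ => Finset.sum_comm)
    _ = _ := Finset.sum_congr rfl fun s _ => Finset.sum_comm

theorem notMem_span_one (hx : LinearIndependent k x) (hx1 : x (Sum.inl none) = 1) (i : γ) :
    x (Sum.inl (some i)) ∉ Submodule.span k {(1 : K)} := by
  have h := hx.notMem_span_image (s := {Sum.inl none}) (x := Sum.inl (some i)) (by simp)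
  rwa [Set.image_singleton, hx1] at h

theorem card_add_min_le_choose_of_isFractionRing {F L : Type} [Field F] [Field L] [Algebra F L]
    [Algebra (MvPolynomial ((γ × β) ⊕ β) k) F] [IsFractionRing (MvPolynomial ((γ × β) ⊕ β) k) F]
    [Algebra (MvPolynomial ((γ × β) ⊕ β) k) L] [IsScalarTower (MvPolynomial ((γ × β) ⊕ β) k) F L]
    [Algebra (MvPolynomial (γ × β) K) L] [IsFractionRing (MvPolynomial (γ × β) K) L]
    [Algebra k F] [Algebra k L] [IsScalarTower k F L]
    [IsScalarTower k (MvPolynomial (γ × β) K) L]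
    (hFL : ∀ f, algebraMap (MvPolynomial ((γ × β) ⊕ β) k) L f =
      algebraMap (MvPolynomial (γ × β) K) L (projHom x f))
    [Nonempty γ] (hx : LinearIndependent k x)
    (hx1 : x (Sum.inl none) = 1) (hz : IsTranscendenceBasis k (fun j => x (Sum.inr j)))
    (hgen : IntermediateField.adjoin k (Set.range x) = ⊤) {ι I : Type} [Fintype ι] [Fintype I]
    (e : ι → K) (he : ∀ p : ι → MvPolynomial β k,
      ∑ i, aeval (fun j => x (Sum.inr j)) (p i) * e i = 0 → ∀ i, p i = 0)
    (B : I → Option γ ⊕ β → Option γ ⊕ β → k)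
    (hB : LinearIndependent k (fun i => fun q : _ × _ => B i q.1 q.2))
    (hsymm : ∀ i s t, B i s t = B i t s)
    (hBx : ∀ i, ∑ s, ∑ t, algebraMap k K (B i s t) * (x s * x t) = 0) :
    Fintype.card I + min (Fintype.card ι) (2 * Fintype.card γ + 1) ≤
      (Fintype.card γ + 2).choose 2 := by
  let P := MvPolynomial ((γ × β) ⊕ β) k
  let R := MvPolynomial (γ × β) K
  obtain ⟨Ω, iΩ, iA, ev, hev, h1, h2, h3⟩ := exists_generic_aeval hx hx1 hz
  have hinj : Function.Injective (projHom (k := k) x) := by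
    rw [injective_iff_map_eq_zero]
    exact fun f hf => hev (by rw [h2 f hf, map_zero])
  have hfin : FiniteDimensional F L := finiteDimensional_of_projHom hFL hinj hz hgen
  have hcF : CharZero F := charZero_of_injective_algebraMap (algebraMap k F).injective
  have hsp : ∀ (f : P) (v : L), f • v = algebraMap R L (projHom x f) * v := fun f v => by
    rw [Algebra.smul_def, hFL]
  let Y : Option γ → L := fun a => algebraMap R L (C (x (Sum.inl a)))
  have hY : LinearIndependent F Y := by
    rw [← LinearIndependent.iff_fractionRing P F, Fintype.linearIndependent_iff]
    intro f hf a
    refine hev (Eq.trans (h1 f (IsFractionRing.injective R L ?_) a) (map_zero ev).symm)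
    rw [map_zero, ← hf, map_sum]
    exact Finset.sum_congr rfl fun a _ => by rw [hsp, map_mul, mul_comm]
  have he' : LinearIndependent F fun i => algebraMap R L (C (e i)) := by
    rw [← LinearIndependent.iff_fractionRing P F, Fintype.linearIndependent_iff]
    intro f hf i
    refine eq_zero_of_sum_projHom_mul_C e he f (IsFractionRing.injective R L ?_) i
    rw [map_zero, ← hf, map_sum]
    exact Finset.sum_congr rfl fun a _ => by rw [hsp, map_mul]
  let M : Option γ → Option γ ⊕ β → P := fun a => Sum.elim (Pi.single a 1) (projMatrix k γ β a)
  have hM : ∀ s, ∑ a, M a s • Y a = algebraMap R L (C (x s)) := by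
    rintro (b | j)
    · rw [Finset.sum_eq_single b]
      · simp [M, Y]
      · intro a _ ha
        simp [M, ha.symm]
      · simp
    · rw [← sum_projHom_projMatrix (k := k) x hx1 j, map_sum]
      exact Finset.sum_congr rfl fun a _ => by rw [hsp, map_mul, mul_comm]; rfl
  let N : I → Option γ → Option γ → P := fun i a b =>
    ∑ s, ∑ t, algebraMap k P (B i s t) * (M a s * M b t)
  have hN : ∀ i a b, N i a b = N i b a := by
    intro i a b
    simp only [N]
    rw [Finset.sum_comm]
    exact Finset.sum_congr rfl fun s _ => Finset.sum_congr rfl fun t _ => by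
      rw [hsymm, mul_comm (M a t)]
  have hNY : ∀ i, ∑ a, ∑ b, N i a b • (Y a * Y b) = 0 := by
    intro i
    have h4 : algebraMap R L (C (∑ s, ∑ t, algebraMap k K (B i s t) * (x s * x t))) = 0 := by
      rw [hBx, map_zero, map_zero]
    rw [← h4]
    have h5 : ∀ s t, algebraMap R L (C (algebraMap k K (B i s t) * (x s * x t))) =
        ∑ a, ∑ b, (algebraMap k P (B i s t) * (M a s * M b t)) • (Y a * Y b) := by
      intro s t
      have h6 : algebraMap R L (C (algebraMap k K (B i s t))) =
          algebraMap R L (projHom x (algebraMap k P (B i s t))) := by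
        rw [AlgHom.commutes]
        rfl
      rw [map_mul, map_mul, map_mul, map_mul, ← hM s, ← hM t, Finset.sum_mul_sum, Finset.mul_sum,
        h6]
      refine Finset.sum_congr rfl fun a _ => ?_
      rw [Finset.mul_sum]
      refine Finset.sum_congr rfl fun b _ => ?_
      rw [hsp, hsp, hsp, map_mul, map_mul, map_mul, map_mul]
      ring
    have h7 : algebraMap R L (C (∑ s, ∑ t, algebraMap k K (B i s t) * (x s * x t))) =
        ∑ s, ∑ t, ∑ a, ∑ b, (algebraMap k P (B i s t) * (M a s * M b t)) • (Y a * Y b) := by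
      rw [map_sum, map_sum]
      refine Finset.sum_congr rfl fun s _ => ?_
      rw [map_sum, map_sum]
      exact Finset.sum_congr rfl fun t _ => h5 s t
    rw [h7]
    rw [← sum_comm_four]
    exact Finset.sum_congr rfl fun a _ => Finset.sum_congr rfl fun b _ => by
      rw [Finset.sum_smul]
      exact Finset.sum_congr rfl fun s _ => Finset.sum_smul
  let Q : I → Sym2 (Option γ) → F := fun i => Sym2.lift ⟨fun a b => algebraMap P F (N i a b),
    fun a b => congrArg _ (hN i a b)⟩
  have hQ : LinearIndependent F Q := by
    rw [← LinearIndependent.iff_fractionRing P F, Fintype.linearIndependent_iff]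
    intro f hf
    refine fun i => hev (Eq.trans (h3 I B hB hsymm hBx f (fun a b => ?_) i) (map_zero ev).symm)
    refine IsFractionRing.injective P F ?_
    have := congrFun hf s(a, b)
    rw [map_zero, map_sum]
    rw [Finset.sum_apply] at this
    refine Eq.trans (Finset.sum_congr rfl fun i _ => ?_) this
    rw [Pi.smul_apply, map_mul, Algebra.smul_def]
    rfl
  have hrel : ∀ i, ∑ a, ∑ b, Q i s(a, b) • (Y a * Y b) = 0 := by
    intro i
    rw [← hNY i]
    exact Finset.sum_congr rfl fun a _ => Finset.sum_congr rfl fun b _ =>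
      algebraMap_smul F (N i a b) (Y a * Y b)
  have hcount := card_add_finrank_span_mul_span_le Y Q hQ hrel
  have hV := finrank_span_eq_card hY
  have hprim := fun E => intermediateField_eq_bot_or_eq_top (F := F) (L := L) (k := k) (K := K)
    (y := fun i => x (Sum.inl (some i))) (z := fun j => x (Sum.inr j)) hz ?_ ?_ ?_ ?_ E
  have hC := two_mul_finrank_le_finrank_mul_self hprim (Submodule.span F (Set.range Y))
    (Submodule.subset_span ⟨none, by simp [Y, hx1]⟩)
  rw [Fintype.card_option] at hV hcount
  have hd := he'.fintype_card_le_finrank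
  rcases hC with hC | hC
  · rw [hC, finrank_top] at hcount
    lia
  · rw [hV] at hC
    lia
  · rw [eq_top_iff, ← hgen, IntermediateField.adjoin_le_iff]
    rintro _ ⟨(_ | a) | j, rfl⟩
    · rw [hx1]
      exact one_mem _
    · exact IntermediateField.subset_adjoin _ _ ⟨Sum.inl a, rfl⟩
    · exact IntermediateField.subset_adjoin _ _ ⟨Sum.inr j, rfl⟩
  · exact fun a => notMem_span_one hx hx1 a
  · intro r
    refine ⟨algebraMap P F (X (Sum.inl r)), ?_⟩
    rw [← IsScalarTower.algebraMap_apply P F L, hFL]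
    rw [projHom, aeval_X]
    rfl
  · intro j
    refine ⟨algebraMap P F (X (Sum.inr j)), ?_⟩
    rw [← IsScalarTower.algebraMap_apply P F L, hFL]
    rw [projHom, aeval_X]
    rfl

theorem card_add_min_le_choose [Nonempty γ] (hx : LinearIndependent k x)
    (hx1 : x (Sum.inl none) = 1) (hz : IsTranscendenceBasis k (fun j => x (Sum.inr j)))
    (hgen : IntermediateField.adjoin k (Set.range x) = ⊤) {ι I : Type} [Fintype ι] [Fintype I]
    (e : ι → K) (he : ∀ p : ι → MvPolynomial β k,
      ∑ i, aeval (fun j => x (Sum.inr j)) (p i) * e i = 0 → ∀ i, p i = 0)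
    (B : I → Option γ ⊕ β → Option γ ⊕ β → k)
    (hB : LinearIndependent k (fun i => fun q : _ × _ => B i q.1 q.2))
    (hsymm : ∀ i s t, B i s t = B i t s)
    (hBx : ∀ i, ∑ s, ∑ t, algebraMap k K (B i s t) * (x s * x t) = 0) :
    Fintype.card I + min (Fintype.card ι) (2 * Fintype.card γ + 1) ≤
      (Fintype.card γ + 2).choose 2 := by
  let P := MvPolynomial ((γ × β) ⊕ β) k
  let R := MvPolynomial (γ × β) K
  obtain ⟨Ω, iΩ, iA, ev, hev, h1, h2, h3⟩ := exists_generic_aeval hx hx1 hz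
  have hinj : Function.Injective (projHom (k := k) x) := by
    rw [injective_iff_map_eq_zero]
    exact fun f hf => hev (by rw [h2 f hf, map_zero])
  let F := FractionRing P
  let L := FractionRing R
  let iPL : Algebra P L := ((algebraMap R L).comp (projHom (k := k) x : P →+* R)).toAlgebra
  have hFL : ∀ f, algebraMap P L f = algebraMap R L (projHom x f) := fun f => rfl
  have hPL : Function.Injective (algebraMap P L) := (IsFractionRing.injective R L).comp hinj
  let iFL : Algebra F L := (IsFractionRing.lift hPL).toAlgebra
  have hFL' : ∀ f, algebraMap F L (algebraMap P F f) = algebraMap P L f := fun f =>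
    IsFractionRing.lift_algebraMap hPL f
  have t1 : IsScalarTower P F L := IsScalarTower.of_algebraMap_eq fun f => (hFL' f).symm
  have t2 : IsScalarTower k F L := by
    refine IsScalarTower.of_algebraMap_eq fun a => ?_
    rw [IsScalarTower.algebraMap_apply k P F, hFL', hFL, AlgHom.commutes,
      ← IsScalarTower.algebraMap_apply k R L]
  exact card_add_min_le_choose_of_isFractionRing (F := F) (L := L) hFL hx hx1 hz hgen e he B hB
    hsymm hBx

end FieldBound

section Reduction

variable {k K : Type} [Field k] [Field K] [Algebra k K] {β : Type}

/-- The powers of the subspace `V` are linearly disjoint: the subalgebra generated by `V` is the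
direct sum of them. -/
def IsGradedSpan (V : Submodule k K) : Prop :=
  ∀ (B N : ℕ) (v : ℕ → K), (∀ m, v m ∈ V ^ (B + m)) → ∑ m ∈ Finset.range N, v m = 0 →
    ∀ m < N, v m = 0

theorem map_homogeneousSubmodule (w : β → K) (m : ℕ) :
    (homogeneousSubmodule β k m).map (aeval (R := k) w).toLinearMap =
      Submodule.span k (Set.range w) ^ m := by
  rw [← homogeneousSubmodule_one_pow, Submodule.map_pow, homogeneousSubmodule_one_eq_span_X,
    Submodule.map_span, ← Set.range_comp]
  congr 3
  ext i
  simp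

theorem aeval_mem_span_pow (w : β → K) {m : ℕ} {f : MvPolynomial β k} (hf : f.IsHomogeneous m) :
    aeval w f ∈ Submodule.span k (Set.range w) ^ m := by
  rw [← map_homogeneousSubmodule]
  exact ⟨f, hf, rfl⟩

theorem IsGradedSpan.sum_aeval_homogeneousComponent {V : Submodule k K} (hV : IsGradedSpan V)
    {w : β → K} (hw : ∀ i, w i ∈ V) {ι : Type} [Fintype ι] {B : ℕ} {e : ι → K}
    (he : ∀ j, e j ∈ V ^ B) {f : ι → MvPolynomial β k} (hf : ∑ j, aeval w (f j) * e j = 0)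
    (t : ℕ) : ∑ j, aeval w (homogeneousComponent t (f j)) * e j = 0 := by
  have hspan : Submodule.span k (Set.range w) ≤ V := by
    rw [Submodule.span_le]
    rintro _ ⟨i, rfl⟩
    exact hw i
  let N := max (t + 1) (∑ j, ((f j).totalDegree + 1))
  refine hV B N (fun t => ∑ j, aeval w (homogeneousComponent t (f j)) * e j) (fun m => ?_) ?_ t
    (lt_of_lt_of_le (Nat.lt_succ_self t) (le_max_left _ _))
  · refine Submodule.sum_mem _ fun j _ => ?_
    rw [mul_comm, pow_add]
    exact Submodule.mul_mem_mul (he j) (pow_le_pow_left' hspan m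
      (aeval_mem_span_pow w (homogeneousComponent_isHomogeneous m _)))
  · rw [Finset.sum_comm, ← hf]
    refine Finset.sum_congr rfl fun j _ => ?_
    rw [← Finset.sum_mul, ← map_sum]
    congr 2
    conv_rhs => rw [← sum_homogeneousComponent (f j)]
    refine (Finset.sum_subset ?_ ?_).symm
    · rw [Finset.range_subset_range]
      refine le_trans ?_ (le_max_right _ _)
      exact Finset.single_le_sum (f := fun j => (f j).totalDegree + 1) (fun _ _ => Nat.zero_le _)
        (Finset.mem_univ j)
    · intro m _ hm
      refine homogeneousComponent_eq_zero _ _ ?_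
      simpa using hm

theorem aeval_sub_eval_smul_mem {W' : Submodule k K} {w : β → K} {b : β → k} {j : β}
    (hb : ∀ i, w i - b i • w j ∈ W') {N : ℕ} {f : MvPolynomial β k} (hf : f.IsHomogeneous N) :
    aeval w f - eval b f • w j ^ N ∈ W' * Submodule.span k (Set.range w) ^ (N - 1) := by
  let W := Submodule.span k (Set.range w)
  have h1 : ∀ l ∈ homogeneousSubmodule β k 1, aeval w l - eval b l • w j ∈ W' := by
    intro l hl
    rw [homogeneousSubmodule_one_eq_span_X] at hl
    induction hl using Submodule.span_induction with
    | mem x hx =>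
      obtain ⟨i, rfl⟩ := hx
      simpa using hb i
    | zero => simp
    | add x y _ _ hx hy =>
      rw [map_add, map_add, add_smul, add_sub_add_comm]
      exact add_mem hx hy
    | smul a x _ hx =>
      rw [map_smul, smul_eval, mul_smul, ← smul_sub]
      exact W'.smul_mem a hx
  induction N generalizing f with
  | zero =>
    rw [← mem_homogeneousSubmodule, homogeneousSubmodule_zero] at hf
    obtain ⟨a, rfl⟩ := Submodule.mem_one.mp hf
    simp [algebraMap_eq, Algebra.smul_def]
  | succ N ih =>
    rw [← mem_homogeneousSubmodule, ← homogeneousSubmodule_one_pow, pow_succ'] at hf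
    induction hf using Submodule.mul_induction_on' with
    | mem_mul_mem l hl g hg =>
      rw [homogeneousSubmodule_one_pow] at hg
      have e1 : aeval w (l * g) - eval b (l * g) • w j ^ (N + 1) =
          (aeval w l - eval b l • w j) * aeval w g +
            eval b l • (w j * (aeval w g - eval b g • w j ^ N)) := by
        simp only [map_mul, Algebra.smul_def]
        ring
      rw [e1]
      refine add_mem (Submodule.mul_mem_mul (h1 l hl) (aeval_mem_span_pow w hg))
        (Submodule.smul_mem _ _ ?_)
      rcases N with _ | N
      · have := ih hg
        rw [mem_homogeneousSubmodule] at hg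
        have hg' : g ∈ homogeneousSubmodule β k 0 := hg
        rw [homogeneousSubmodule_zero] at hg'
        obtain ⟨a, rfl⟩ := Submodule.mem_one.mp hg'
        simp [algebraMap_eq, Algebra.smul_def]
      · have := Submodule.mul_mem_mul (Submodule.subset_span ⟨j, rfl⟩ : w j ∈ W) (ih hg)
        rwa [mul_left_comm, Nat.add_sub_cancel, ← pow_succ'] at this
    | add x _ y _ hx hy =>
      rw [map_add, map_add, add_smul, add_sub_add_comm]
      exact add_mem hx hy

theorem eval_smul_of_isHomogeneous [Fintype β] {N : ℕ} {f : MvPolynomial β k}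
    (hf : f.IsHomogeneous N) (r : k) (a : β → k) : eval (r • a) f = r ^ N * eval a f := by
  rw [eval_eq', eval_eq', Finset.mul_sum]
  refine Finset.sum_congr rfl fun d hd => ?_
  rw [hf.degree_eq_sum_deg_support hd]
  simp only [Pi.smul_apply, smul_eq_mul, mul_pow, Finset.prod_mul_distrib]
  rw [Finset.prod_pow_eq_pow_sum, ← Finsupp.degree_eq_sum, ← Finsupp.degree_apply]
  ring

theorem exists_span_pow_le_mul [Infinite k] [Fintype β] {w : β → K} {N : ℕ}
    {f : MvPolynomial β k} (hf : f.IsHomogeneous N) (hf0 : f ≠ 0) (hwf : aeval w f = 0) :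
    ∃ W' ≤ Submodule.span k (Set.range w), Module.finrank k W' < Fintype.card β ∧ N ≠ 0 ∧
      Submodule.span k (Set.range w) ^ N ≤ W' * Submodule.span k (Set.range w) ^ (N - 1) := by
  classical
  have hN : N ≠ 0 := by
    rintro rfl
    have hf' : f ∈ homogeneousSubmodule β k 0 := hf
    rw [homogeneousSubmodule_zero] at hf'
    obtain ⟨a, rfl⟩ := Submodule.mem_one.mp hf'
    rw [algebraMap_eq, aeval_C, map_eq_zero] at hwf
    simp [hwf] at hf0
  obtain ⟨a, ha⟩ : ∃ a, eval a f ≠ 0 := by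
    by_contra! h
    exact hf0 (hf.eq_zero_of_forall_eval_eq_zero h)
  obtain ⟨j, hj⟩ : ∃ j, a j ≠ 0 := by
    by_contra! h
    refine ha ?_
    have : a = (0 : k) • a := by ext i; simp [h i]
    rw [this, eval_smul_of_isHomogeneous hf, zero_pow hN, zero_mul]
  let b : β → k := (a j)⁻¹ • a
  have hb : eval b f ≠ 0 := by
    rw [eval_smul_of_isHomogeneous hf]
    exact mul_ne_zero (pow_ne_zero _ (inv_ne_zero hj)) ha
  let w' : {i // i ≠ j} → K := fun i => w i - b i • w j
  have hbw : ∀ i, w i - b i • w j ∈ Submodule.span k (Set.range w') := by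
    intro i
    by_cases hij : i = j
    · subst hij
      have : b i = 1 := inv_mul_cancel₀ hj
      rw [this, one_smul, sub_self]
      exact zero_mem _
    · exact Submodule.subset_span ⟨⟨i, hij⟩, rfl⟩
  refine ⟨Submodule.span k (Set.range w'), ?_, ?_, hN, ?_⟩
  · rw [Submodule.span_le]
    rintro _ ⟨i, rfl⟩
    exact sub_mem (Submodule.subset_span ⟨_, rfl⟩)
      (Submodule.smul_mem _ _ (Submodule.subset_span ⟨_, rfl⟩))
  · refine lt_of_le_of_lt (finrank_range_le_card w') ?_
    rw [Fintype.card_subtype_compl, Fintype.card_subtype_eq]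
    exact Nat.sub_lt (Fintype.card_pos_iff.mpr ⟨j⟩) one_pos
  · have hwj : w j ^ N ∈ Submodule.span k (Set.range w') *
        Submodule.span k (Set.range w) ^ (N - 1) := by
      have := aeval_sub_eval_smul_mem hbw hf
      rw [hwf, zero_sub, neg_mem_iff] at this
      exact (Submodule.smul_mem_iff _ hb).mp this
    rw [← map_homogeneousSubmodule w N]
    rintro _ ⟨g, hg, rfl⟩
    have := add_mem (aeval_sub_eval_smul_mem hbw hg) (Submodule.smul_mem _ (eval b g) hwj)
    rwa [sub_add_cancel] at this

theorem exists_algebraicIndependent_reduction [Infinite k] {V : Submodule k K}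
    [FiniteDimensional k V] (hV : IsGradedSpan V) :
    ∃ (r : ℕ) (w : Fin r → K) (B : ℕ), (∀ i, w i ∈ V) ∧ AlgebraicIndependent k w ∧
      V ^ (B + 1) ≤ Submodule.span k (Set.range w) * V ^ B := by
  classical
  have hex : ∃ r, ∃ W ≤ V, Module.finrank k W = r ∧ ∃ B, V ^ (B + 1) ≤ W * V ^ B :=
    ⟨_, V, le_rfl, rfl, 0, by simp⟩
  obtain ⟨W, hWV, hr, B, hB⟩ := Nat.find_spec hex
  have hmin := fun m => Nat.find_min hex (m := m)
  have hfin : FiniteDimensional k W := Submodule.finiteDimensional_of_le hWV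
  let w : Fin (Module.finrank k W) → K := fun i => Module.finBasis k W i
  have hspan : Submodule.span k (Set.range w) = W := by
    have := congrArg (Submodule.map W.subtype) (Module.finBasis k W).span_eq
    rwa [Submodule.map_span, ← Set.range_comp, Submodule.map_top, Submodule.range_subtype] at this
  refine ⟨_, w, B, fun i => hWV (Module.finBasis k W i).2, ?_, by rwa [hspan]⟩
  rw [algebraicIndependent_iff]
  intro f hf
  by_contra hf0
  obtain ⟨t, ht⟩ : ∃ t, homogeneousComponent t f ≠ 0 := by
    by_contra! h
    exact hf0 (by rw [← sum_homogeneousComponent f, Finset.sum_eq_zero fun t _ => h t])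
  have hwt : aeval w (homogeneousComponent t f) = 0 := by
    have := hV.sum_aeval_homogeneousComponent (fun i => hWV (Module.finBasis k W i).2)
      (ι := Unit) (B := 0) (e := fun _ => 1) (fun _ => by simp) (f := fun _ => f)
      (by simpa using hf) t
    simpa using this
  obtain ⟨W', hW', hlt, hN, hle⟩ := exists_span_pow_le_mul
    (homogeneousComponent_isHomogeneous t f) ht hwt
  rw [hspan] at hle hW'
  rw [Fintype.card_fin, hr] at hlt
  refine hmin _ hlt ⟨W', hW'.trans hWV, rfl, t - 1 + B, ?_⟩
  have hpow : ∀ s, V ^ (B + s) ≤ W ^ s * V ^ B := by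
    intro s
    induction s with
    | zero => simp
    | succ s ih =>
      calc V ^ (B + (s + 1)) = V ^ (B + s) * V := by rw [← add_assoc, pow_succ]
        _ ≤ W ^ s * V ^ B * V := mul_le_mul' ih le_rfl
        _ = W ^ s * V ^ (B + 1) := by rw [mul_assoc, ← pow_succ]
        _ ≤ W ^ s * (W * V ^ B) := mul_le_mul' le_rfl hB
        _ = W ^ (s + 1) * V ^ B := by rw [← mul_assoc, ← pow_succ]
  calc V ^ (t - 1 + B + 1) = V ^ (B + t) := by congr 1; lia
    _ ≤ W ^ t * V ^ B := hpow t
    _ ≤ W' * W ^ (t - 1) * V ^ B := mul_le_mul' hle le_rfl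
    _ ≤ W' * V ^ (t - 1) * V ^ B := mul_le_mul'
      (mul_le_mul' le_rfl (pow_le_pow_left' hWV _)) le_rfl
    _ = W' * V ^ (t - 1 + B) := by rw [mul_assoc, ← pow_add]

end Reduction

section HilbertBound

variable {k K : Type} [Field k] [Field K] [Algebra k K] {β : Type} [Fintype β]

theorem finrank_homogeneousSubmodule (m : ℕ) :
    Module.finrank k (homogeneousSubmodule β k m) = (Fintype.card β).multichoose m := by
  classical
  have hs : {d : β →₀ ℕ | d.degree = m} =
      ((Finset.univ : Finset β).finsuppAntidiag m : Set (β →₀ ℕ)) := by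
    ext d
    simp [Finsupp.degree_eq_sum]
  rw [homogeneousSubmodule_eq_finsupp_supported, hs]
  refine (LinearEquiv.finrank_eq (AddMonoidAlgebra.supportedEquivFinsupp (S := k) (R := k)
    ((Finset.univ : Finset β).finsuppAntidiag m : Set (β →₀ ℕ)))).trans ?_
  rw [Module.finrank_finsupp_self]
  refine (Fintype.card_coe _).trans ?_
  rw [Finset.card_finsuppAntidiag_nat_eq_multichoose, Finset.card_univ]

theorem finite_homogeneousSubmodule (m : ℕ) : Module.Finite k (homogeneousSubmodule β k m) :=
  Module.Finite.iff_fg.mpr (homogeneousSubmodule_fg β k m)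

theorem multichoose_le_finrank_pow {V : Submodule k K} [FiniteDimensional k V] {w : β → K}
    (hwV : ∀ i, w i ∈ V) (hw : AlgebraicIndependent k w) (m : ℕ) :
    (Fintype.card β).multichoose m ≤ Module.finrank k (V ^ m : Submodule k K) := by
  have hspan : Submodule.span k (Set.range w) ≤ V := by
    rw [Submodule.span_le]
    rintro _ ⟨i, rfl⟩
    exact hwV i
  have hfin : FiniteDimensional k (V ^ m : Submodule k K) :=
    Module.Finite.iff_fg.mpr (Submodule.FG.pow (Module.Finite.iff_fg.mp ‹_›) m)
  rw [← finrank_homogeneousSubmodule (k := k) m]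
  rw [(Submodule.equivMapOfInjective (aeval w).toLinearMap hw
    (homogeneousSubmodule β k m)).finrank_eq, map_homogeneousSubmodule]
  exact Submodule.finrank_mono (pow_le_pow_left' hspan m)

theorem exists_finrank_pow_le {V : Submodule k K} [FiniteDimensional k V] (hV : IsGradedSpan V)
    {w : β → K} (hwV : ∀ i, w i ∈ V) (hw : AlgebraicIndependent k w) {B : ℕ}
    (hB : V ^ (B + 1) ≤ Submodule.span k (Set.range w) * V ^ B) :
    ∃ (D : ℕ) (e : Fin D → K) (T : ℕ),
      (∀ p : Fin D → MvPolynomial β k, ∑ i, aeval w (p i) * e i = 0 → ∀ i, p i = 0) ∧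
      ∀ j, Module.finrank k (V ^ (B + j) : Submodule k K) ≤
        D * (Fintype.card β).multichoose (j + T) := by
  classical
  have hfin : ∀ m, FiniteDimensional k (V ^ m : Submodule k K) := fun m =>
    Module.Finite.iff_fg.mpr (Submodule.FG.pow (Module.Finite.iff_fg.mp ‹_›) m)
  let b : Fin (Module.finrank k (V ^ B : Submodule k K)) → K := fun i =>
    Module.finBasis k (V ^ B : Submodule k K) i
  have hbV : ∀ i, b i ∈ V ^ B := fun i => (Module.finBasis k (V ^ B : Submodule k K) i).2
  have hspan : Submodule.span k (Set.range b) = V ^ B := by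
    have := congrArg (Submodule.map (V ^ B).subtype)
      (Module.finBasis k (V ^ B : Submodule k K)).span_eq
    rwa [Submodule.map_span, ← Set.range_comp, Submodule.map_top, Submodule.range_subtype] at this
  obtain ⟨s, hs, hmax⟩ : ∃ s : Set (Fin (Module.finrank k (V ^ B : Submodule k K))),
      (∀ p : s → MvPolynomial β k, ∑ i, aeval w (p i) * b i = 0 → ∀ i, p i = 0) ∧
      ∀ i ∉ s, ∃ a : MvPolynomial β k, a ≠ 0 ∧ ∃ p : s → MvPolynomial β k,
        aeval w a * b i = ∑ j, aeval w (p j) * b j := by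
    let iA : Algebra (MvPolynomial β k) K := (aeval (R := k) w : MvPolynomial β k →+* K).toAlgebra
    obtain ⟨s, hs, hmax⟩ := exists_maximal_linearIndepOn (MvPolynomial β k) b
    refine ⟨s, Fintype.linearIndependent_iff.mp hs, fun i hi => ?_⟩
    obtain ⟨a, ha, hai⟩ := hmax i hi
    rw [Set.image_eq_range, Submodule.mem_span_range_iff_exists_fun] at hai
    obtain ⟨p, hp⟩ := hai
    exact ⟨a, ha, p, hp.symm⟩
  have key : ∀ i, ∃ (a : MvPolynomial β k) (t : ℕ) (p : s → MvPolynomial β k), a ≠ 0 ∧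
      a.IsHomogeneous t ∧ (∀ j, (p j).IsHomogeneous t) ∧
      aeval w a * b i = ∑ j, aeval w (p j) * b j := by
    intro i
    by_cases hi : i ∈ s
    · refine ⟨1, 0, Pi.single ⟨i, hi⟩ 1, one_ne_zero, isHomogeneous_one _ _, fun j => ?_, ?_⟩
      · by_cases hj : j = ⟨i, hi⟩
        · subst hj
          rw [Pi.single_eq_same]
          exact isHomogeneous_one _ _
        · rw [Pi.single_eq_of_ne hj]
          exact isHomogeneous_zero _ _ _
      · rw [Finset.sum_eq_single ⟨i, hi⟩]
        · simp
        · intro j _ hj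
          rw [Pi.single_eq_of_ne hj]
          simp
        · simp
    · obtain ⟨a, ha, p, hp⟩ := hmax i hi
      obtain ⟨t, ht⟩ : ∃ t, homogeneousComponent t a ≠ 0 := by
        by_contra! h
        exact ha (by rw [← sum_homogeneousComponent a, Finset.sum_eq_zero fun t _ => h t])
      refine ⟨_, t, fun j => homogeneousComponent t (p j), ht,
        homogeneousComponent_isHomogeneous _ _, fun j => homogeneousComponent_isHomogeneous _ _, ?_⟩
      have := hV.sum_aeval_homogeneousComponent hwV (ι := Option s) (B := B)
        (e := fun o => o.elim (b i) (fun j => b j)) (by rintro (_ | j) <;> exact hbV _)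
        (f := fun o => o.elim a (fun j => - p j)) (by simp [Fintype.sum_option, hp]) t
      simpa [Fintype.sum_option, add_neg_eq_zero] using this
  choose a t p ha0 hat hpt hap using key
  let g := ∏ i, a i
  let T := ∑ i, t i
  let p' : Fin (Module.finrank k (V ^ B : Submodule k K)) → s → MvPolynomial β k := fun i j =>
    (∏ l ∈ Finset.univ.erase i, a l) * p i j
  have hp' : ∀ i j, (p' i j).IsHomogeneous T := fun i j => by
    have := (IsHomogeneous.prod (Finset.univ.erase i) a t fun l _ => hat l).mul (hpt i j)
    rwa [Finset.sum_erase_add _ _ (Finset.mem_univ i)] at this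
  have hg : ∀ i, aeval w g * b i = ∑ j, aeval w (p' i j) * b j := fun i => by
    simp only [p', map_mul, mul_assoc, ← Finset.mul_sum]
    rw [← hap, ← mul_assoc, ← map_mul, Finset.prod_erase_mul _ _ (Finset.mem_univ i)]
  have hg0 : aeval w g ≠ 0 := fun h =>
    Finset.prod_ne_zero_iff.mpr (fun i _ => ha0 i) (hw (h.trans (map_zero _).symm))
  have hpow : ∀ j, V ^ (B + j) ≤ Submodule.span k (Set.range w) ^ j * V ^ B := by
    intro j
    induction j with
    | zero => simp
    | succ j ih =>
      calc V ^ (B + (j + 1)) = V ^ (B + j) * V := by rw [← add_assoc, pow_succ]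
        _ ≤ Submodule.span k (Set.range w) ^ j * V ^ B * V := mul_le_mul' ih le_rfl
        _ = Submodule.span k (Set.range w) ^ j * V ^ (B + 1) := by rw [mul_assoc, ← pow_succ]
        _ ≤ Submodule.span k (Set.range w) ^ j * (Submodule.span k (Set.range w) * V ^ B) :=
          mul_le_mul' le_rfl hB
        _ = Submodule.span k (Set.range w) ^ (j + 1) * V ^ B := by rw [← mul_assoc, ← pow_succ]
  let eq := Fintype.equivFin s
  refine ⟨Fintype.card s, fun i => b (eq.symm i), T, fun q hq i => ?_, fun j => ?_⟩
  · have := hs (fun l => q (eq l)) (by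
      rw [← hq, ← eq.symm.sum_comp]
      simp) (eq.symm i)
    simpa using this
  · have hfh := finite_homogeneousSubmodule (k := k) (β := β) (j + T)
    let Φ : (s → homogeneousSubmodule β k (j + T)) →ₗ[k] K :=
      ∑ l : s, (LinearMap.mulRight k (b l)) ∘ₗ (aeval w).toLinearMap ∘ₗ
        (homogeneousSubmodule β k (j + T)).subtype ∘ₗ
          LinearMap.proj (φ := fun _ : s => homogeneousSubmodule β k (j + T)) l
    have hΦ : ∀ q, Φ q = ∑ l, aeval w (q l : MvPolynomial β k) * b l := fun q => by
      simp [Φ]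
    have hle : (V ^ (B + j)).map (LinearMap.mulLeft k (aeval w g)) ≤ LinearMap.range Φ := by
      rw [Submodule.map_le_iff_le_comap]
      refine (hpow j).trans (Submodule.mul_le.mpr ?_)
      intro x hx y hy
      rw [← map_homogeneousSubmodule] at hx
      obtain ⟨h, hh, rfl⟩ := hx
      rw [← hspan] at hy
      induction hy using Submodule.span_induction with
      | mem y hy =>
        obtain ⟨i, rfl⟩ := hy
        refine ⟨fun l => ⟨h * p' i l, IsHomogeneous.mul hh (hp' i l)⟩, ?_⟩
        rw [hΦ]
        simp only [map_mul, mul_assoc, ← Finset.mul_sum, ← hg, AlgHom.toLinearMap_apply,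
          LinearMap.mulLeft_apply]
        rw [mul_left_comm]
      | zero => rw [mul_zero]; exact zero_mem _
      | add x y _ _ hx hy => rw [mul_add]; exact add_mem hx hy
      | smul r x _ hx => rw [mul_smul_comm]; exact Submodule.smul_mem _ _ hx
    rw [(Submodule.equivMapOfInjective (LinearMap.mulLeft k (aeval w g))
      (fun x y hxy => mul_left_cancel₀ hg0 hxy) (V ^ (B + j))).finrank_eq]
    refine (Submodule.finrank_mono hle).trans ((LinearMap.finrank_range_le Φ).trans ?_)
    rw [Module.finrank_pi_fintype, Finset.sum_const, finrank_homogeneousSubmodule, Finset.card_univ,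
      smul_eq_mul]

end HilbertBound

section Asymptotics

open Filter Topology

theorem pow_le_factorial_mul_multichoose (s m : ℕ) :
    m ^ s ≤ s.factorial * (s + 1).multichoose m := by
  rw [Nat.multichoose_eq, show s + 1 + m - 1 = m + s by lia, Nat.choose_symm_add,
    ← Nat.descFactorial_eq_factorial_mul_choose]
  refine le_trans (Nat.pow_le_pow_left ?_ s) (Nat.pow_sub_le_descFactorial (m + s) s)
  lia

theorem factorial_mul_multichoose_le_pow (s m : ℕ) :
    s.factorial * (s + 1).multichoose m ≤ (m + s) ^ s := by
  rw [Nat.multichoose_eq, show s + 1 + m - 1 = m + s by lia, Nat.choose_symm_add,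
    ← Nat.descFactorial_eq_factorial_mul_choose]
  exact Nat.descFactorial_le_pow (m + s) s

/-- The growth of a Hilbert function determines its dimension and bounds its degree. -/
theorem eq_and_le_of_tendsto {h : ℕ → ℕ} {n d s D B T : ℕ} (hd : d ≠ 0)
    (hh : Tendsto (fun m : ℕ => (h m : ℝ) * (n.factorial : ℝ) / (m : ℝ) ^ n) atTop (𝓝 (d : ℝ)))
    (hlow : ∀ m, (s + 1).multichoose m ≤ h m)
    (hup : ∀ j, h (B + j) ≤ D * (s + 1).multichoose (j + T)) : s = n ∧ d ≤ D := by
  have hs0 : (0 : ℝ) < s.factorial := by exact_mod_cast s.factorial_pos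
  have hn0 : (0 : ℝ) < n.factorial := by exact_mod_cast n.factorial_pos
  have hsn : s ≤ n := by
    by_contra! hns
    have h1 : Tendsto (fun m : ℕ => (n.factorial / s.factorial : ℝ) * (m : ℝ) ^ (s - n)) atTop
        atTop :=
      ((tendsto_pow_atTop (by lia)).comp tendsto_natCast_atTop_atTop).const_mul_atTop
        (by positivity)
    refine not_tendsto_nhds_of_tendsto_atTop (tendsto_atTop_mono' _ ?_ h1) _ hh
    filter_upwards [eventually_gt_atTop 0] with m hm
    have hm' : (0 : ℝ) < m := by exact_mod_cast hm
    rw [le_div_iff₀ (by positivity), mul_assoc, ← pow_add, Nat.sub_add_cancel hns.le,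
      div_mul_eq_mul_div,
      div_le_iff₀ hs0]
    have h2 : (m : ℝ) ^ s ≤ s.factorial * h m := by
      exact_mod_cast (pow_le_factorial_mul_multichoose s m).trans (Nat.mul_le_mul_left _ (hlow m))
    nlinarith
  have hlim : Tendsto (fun m : ℕ => (D : ℝ) * (n.factorial / s.factorial) *
      (1 + ((T + s : ℕ) : ℝ) / m) ^ s * ((m : ℝ) ^ (n - s))⁻¹) atTop
      (𝓝 (if s = n then (D : ℝ) else 0)) := by
    have h1 : Tendsto (fun m : ℕ => (1 + ((T + s : ℕ) : ℝ) / m) ^ s) atTop (𝓝 ((1 + 0) ^ s)) :=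
      ((tendsto_const_div_atTop_nhds_zero_nat _).const_add 1).pow s
    have h2 := h1.const_mul ((D : ℝ) * (n.factorial / s.factorial))
    split_ifs with h
    · subst h
      simpa [hn0.ne'] using h2
    · have h3 : Tendsto (fun m : ℕ => ((m : ℝ) ^ (n - s))⁻¹) atTop (𝓝 0) :=
        tendsto_inv_atTop_zero.comp ((tendsto_pow_atTop (by lia)).comp tendsto_natCast_atTop_atTop)
      simpa using h2.mul h3
  have hle : (d : ℝ) ≤ if s = n then (D : ℝ) else 0 := by
    refine le_of_tendsto_of_tendsto hh hlim ?_
    filter_upwards [eventually_gt_atTop B] with m hm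
    have hm' : (0 : ℝ) < m := by exact_mod_cast (Nat.zero_le B).trans_lt hm
    have h4 : s.factorial * h m ≤ D * (m + (T + s)) ^ s := by
      obtain ⟨j, rfl⟩ := Nat.exists_eq_add_of_lt hm
      calc s.factorial * h (B + j + 1) ≤ s.factorial * (D * (s + 1).multichoose (j + 1 + T)) :=
            Nat.mul_le_mul_left _ (hup (j + 1))
        _ = D * (s.factorial * (s + 1).multichoose (j + 1 + T)) := by ring
        _ ≤ D * (B + j + 1 + (T + s)) ^ s := Nat.mul_le_mul_left _
          ((factorial_mul_multichoose_le_pow s _).trans (Nat.pow_le_pow_left (by lia) s))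
    have h5 : (s.factorial : ℝ) * h m ≤ D * ((m : ℝ) + (T + s : ℕ)) ^ s := by exact_mod_cast h4
    have h6 : (D : ℝ) * (n.factorial / s.factorial) * (1 + ((T + s : ℕ) : ℝ) / m) ^ s *
        ((m : ℝ) ^ (n - s))⁻¹ =
        (n.factorial / s.factorial) * (D * ((m : ℝ) + (T + s : ℕ)) ^ s) / (m : ℝ) ^ n := by
      have h7 : (1 + ((T + s : ℕ) : ℝ) / m) = ((m : ℝ) + (T + s : ℕ)) / m := by field_simp
      have h8 : (m : ℝ) ^ n = (m : ℝ) ^ s * (m : ℝ) ^ (n - s) := by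
        rw [← pow_add, Nat.add_sub_cancel' hsn]
      rw [h7, h8, div_pow]
      field_simp
    rw [h6]
    refine div_le_div_of_nonneg_right ?_ (by positivity)
    rw [div_mul_eq_mul_div, le_div_iff₀ hs0]
    nlinarith
  have hd0 : (0 : ℝ) < d := by exact_mod_cast Nat.pos_of_ne_zero hd
  split_ifs at hle with h
  · exact ⟨h, by exact_mod_cast hle⟩
  · linarith

end Asymptotics

section Graded

variable {k K : Type} [Field k] [Field K] [Algebra k K]

theorem IsGradedSpan.one_notMem {V : Submodule k K} (hV : IsGradedSpan V) : (1 : K) ∉ V := by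
  intro h
  refine one_ne_zero (α := K) (hV 0 2 (fun m => if m = 0 then 1 else if m = 1 then -1 else 0)
    (fun m => ?_) (by simp [Finset.sum_range_succ]) 0 two_pos)
  rcases m with _ | _ | m
  · simp
  · simpa using h
  · simp

open scoped IntermediateField.algebraAdjoinAdjoin in
theorem isTranscendenceBasis_of_reduction {β : Type} {V : Submodule k K} [FiniteDimensional k V]
    (hV0 : V ≠ ⊥) (hgen : IntermediateField.adjoin k (V : Set K) = ⊤) {w : β → K}
    (hw : AlgebraicIndependent k w) {B : ℕ}
    (hB : V ^ (B + 1) ≤ Submodule.span k (Set.range w) * V ^ B) : IsTranscendenceBasis k w := by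
  let F := IntermediateField.adjoin k (Set.range w)
  have hint : ∀ v ∈ V, IsIntegral F v := by
    intro v hv
    let N := Submodule.span F ((V ^ B : Submodule k K) : Set K)
    have hsub : ∀ n ∈ V ^ B, n ∈ N := fun n hn => Submodule.subset_span hn
    refine isIntegral_of_smul_mem_submodule N ?_ ?_ v ?_
    · obtain ⟨a, ha, ha0⟩ := (Submodule.ne_bot_iff _).mp hV0
      exact (Submodule.ne_bot_iff _).mpr
        ⟨a ^ B, hsub _ (Submodule.pow_mem_pow _ ha B), pow_ne_zero B ha0⟩
    · obtain ⟨s, hs⟩ := Submodule.FG.pow (Module.Finite.iff_fg.mp ‹FiniteDimensional k V›) B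
      refine ⟨s, le_antisymm (Submodule.span_mono ?_) (Submodule.span_le.mpr fun x hx => ?_)⟩
      · rw [← hs]
        exact Submodule.subset_span
      · have hx' : x ∈ Submodule.span k (s : Set K) := by rw [hs]; exact hx
        exact Submodule.span_le_restrictScalars k F (s : Set K) hx'
    · intro n hn
      induction hn using Submodule.span_induction with
      | mem x hx =>
        have h1 : v * x ∈ V ^ (B + 1) := by
          rw [pow_succ']
          exact Submodule.mul_mem_mul hv hx
        have h2 : Submodule.span k (Set.range w) * V ^ B ≤ N.restrictScalars k := by
          rw [Submodule.mul_le]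
          intro a ha b hb
          have haF : a ∈ F := by
            have : Submodule.span k (Set.range w) ≤ F.toSubalgebra.toSubmodule :=
              Submodule.span_le.mpr (IntermediateField.subset_adjoin k _)
            exact this ha
          exact N.smul_mem (⟨a, haF⟩ : F) (hsub b hb)
        exact h2 (hB h1)
      | zero => rw [smul_zero]; exact zero_mem _
      | add x y _ _ hx hy => rw [smul_add]; exact add_mem hx hy
      | smul r x _ hx => rw [smul_comm]; exact Submodule.smul_mem _ r hx
  have halg : Algebra.IsAlgebraic F K := by
    have h := IntermediateField.isAlgebraic_adjoin hint
    have htop : IntermediateField.adjoin F (V : Set K) = ⊤ := by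
      rw [eq_top_iff]
      have h3 : (⊤ : IntermediateField k K) ≤
          (IntermediateField.adjoin F (V : Set K)).restrictScalars k := by
        rw [← hgen, IntermediateField.adjoin_le_iff]
        exact IntermediateField.subset_adjoin F _
      exact fun x _ => h3 (IntermediateField.mem_top (x := x))
    rw [htop] at h
    exact (IntermediateField.topEquiv (F := F) (E := K)).isAlgebraic
  rw [hw.isTranscendenceBasis_iff_isAlgebraic]
  exact (IsFractionRing.comap_isAlgebraic_iff (A := Algebra.adjoin k (Set.range w)) (K := F)
    (C := K)).mpr halg

theorem exists_sup_span_eq {r c : ℕ} {V : Submodule k K} [FiniteDimensional k V]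
    (hVr : Module.finrank k V = r + c) {w : Fin r → K} (hwV : ∀ i, w i ∈ V)
    (hw : LinearIndependent k w) : ∃ y : Fin c → K, LinearIndependent k (Sum.elim y w) ∧
      Submodule.span k (Set.range (Sum.elim y w)) = V := by
  have hle : Submodule.span k (Set.range w) ≤ V := by
    rw [Submodule.span_le]
    rintro _ ⟨i, rfl⟩
    exact hwV i
  obtain ⟨U, hdis, hU⟩ := IsModularLattice.exists_disjoint_and_sup_eq hle
  have hfW : FiniteDimensional k (Submodule.span k (Set.range w)) :=
    Submodule.finiteDimensional_of_le hle
  have hfU : FiniteDimensional k U := Submodule.finiteDimensional_of_le (hU ▸ le_sup_right)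
  have hUc : Module.finrank k U = c := by
    have h1 := Submodule.finrank_sup_add_finrank_inf_eq (Submodule.span k (Set.range w)) U
    rw [hU, hdis.eq_bot, finrank_bot, finrank_span_eq_card hw, hVr, Fintype.card_fin] at h1
    lia
  let b := Module.finBasisOfFinrankEq k U hUc
  have hspan : Submodule.span k (Set.range fun i => (b i : K)) = U := by
    have := congrArg (Submodule.map U.subtype) b.span_eq
    rwa [Submodule.map_span, ← Set.range_comp, Submodule.map_top, Submodule.range_subtype] at this
  refine ⟨fun i => b i, LinearIndependent.sum_type ?_ hw ?_, ?_⟩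
  · exact b.linearIndependent.map' U.subtype (Submodule.ker_subtype U)
  · rw [hspan]
    exact hdis.symm
  · rw [Set.Sum.elim_range, Submodule.span_union, hspan, sup_comm, hU]

theorem linearIndependent_sumElim_optionElim {γ β : Type} {y : γ → K} {w : β → K}
    (h : LinearIndependent k (Sum.elim y w))
    (h1 : (1 : K) ∉ Submodule.span k (Set.range (Sum.elim y w))) :
    LinearIndependent k (Sum.elim (fun o : Option γ => o.elim 1 y) w) := by
  have h2 : LinearIndependent k (fun o : Option (γ ⊕ β) => o.elim 1 (Sum.elim y w)) :=
    linearIndependent_option.mpr ⟨h, h1⟩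
  have h3 := h2.comp (Sum.elim (Option.map Sum.inl) (some ∘ Sum.inr) : Option γ ⊕ β → _) (by
    rintro ((_ | a) | a) ((_ | b) | b) hab <;> simp_all)
  convert h3 using 1
  ext ((_ | a) | a) <;> rfl

theorem finrank_sup_one_mul_sup_one_le {V : Submodule k K} [FiniteDimensional k V] :
    Module.finrank k ((1 ⊔ V) * (1 ⊔ V) : Submodule k K) ≤
      1 + Module.finrank k V + Module.finrank k (V ^ 2 : Submodule k K) := by
  have hfin : FiniteDimensional k (V ^ 2 : Submodule k K) :=
    Module.Finite.iff_fg.mpr (Submodule.FG.pow (Module.Finite.iff_fg.mp ‹_›) 2)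
  have hfin1 : FiniteDimensional k (1 : Submodule k K) := by
    rw [Submodule.one_eq_span]
    infer_instance
  have h1 : Module.finrank k (1 : Submodule k K) ≤ 1 := by
    rw [Submodule.one_eq_span]
    exact (finrank_span_singleton one_ne_zero).le
  have h : (1 ⊔ V) * (1 ⊔ V) ≤ (1 ⊔ V) ⊔ V ^ 2 := by
    rw [Submodule.sup_mul, Submodule.mul_sup, Submodule.mul_sup, one_mul, one_mul, mul_one, ← sq]
    exact sup_le le_sup_left (sup_le (le_sup_right.trans le_sup_left) le_sup_right)
  have h2 := Submodule.finrank_add_le_finrank_add_finrank (1 : Submodule k K) V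
  have h3 := Submodule.finrank_add_le_finrank_add_finrank (1 ⊔ V : Submodule k K) (V ^ 2)
  have h4 := Submodule.finrank_mono h
  lia

/-- The symmetric bilinear relations among finitely many elements. -/
theorem exists_symm_relations {σ : Type} [Fintype σ] [DecidableEq σ] (x : σ → K)
    {U : Submodule k K} (hU : ∀ s, x s ∈ U) [FiniteDimensional k (U * U : Submodule k K)] :
    ∃ (N : ℕ) (B : Fin N → σ → σ → k),
      (Fintype.card σ + 1).choose 2 ≤ N + Module.finrank k (U * U : Submodule k K) ∧
      LinearIndependent k (fun i => fun q : σ × σ => B i q.1 q.2) ∧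
      (∀ i s t, B i s t = B i t s) ∧
      ∀ i, ∑ s, ∑ t, algebraMap k K (B i s t) * (x s * x t) = 0 := by
  let Ψ : (Sym2 σ → k) →ₗ[k] K :=
    ∑ s, ∑ t, (LinearMap.toSpanSingleton k K (x s * x t)) ∘ₗ LinearMap.proj s(s, t)
  have hΨ : ∀ g, Ψ g = ∑ s, ∑ t, algebraMap k K (g s(s, t)) * (x s * x t) := fun g => by
    simp [Ψ, Algebra.smul_def]
  let b := Module.finBasis k (LinearMap.ker Ψ)
  refine ⟨_, fun i s t => (b i : Sym2 σ → k) s(s, t), ?_, ?_, fun i s t =>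
    congrArg (b i : Sym2 σ → k) Sym2.eq_swap,
    fun i => ?_⟩
  · have h1 := LinearMap.finrank_range_add_finrank_ker Ψ
    rw [Module.finrank_pi, Sym2.card] at h1
    have h2 : LinearMap.range Ψ ≤ U * U := by
      rintro _ ⟨g, rfl⟩
      rw [hΨ]
      refine Submodule.sum_mem _ fun s _ => Submodule.sum_mem _ fun t _ => ?_
      rw [← Algebra.smul_def]
      exact Submodule.smul_mem _ _ (Submodule.mul_mem_mul (hU s) (hU t))
    have h3 := Submodule.finrank_mono h2
    lia
  · have h1 : LinearIndependent k fun i => (b i : Sym2 σ → k) :=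
      b.linearIndependent.map' (LinearMap.ker Ψ).subtype (Submodule.ker_subtype _)
    have hsurj : Function.Surjective fun q : σ × σ => s(q.1, q.2) := fun z =>
      z.inductionOn fun a b => ⟨(a, b), rfl⟩
    exact h1.map' (LinearMap.funLeft k k fun q : σ × σ => s(q.1, q.2))
      (LinearMap.ker_eq_bot.mpr (LinearMap.funLeft_injective_of_surjective k k _ hsurj))
  · rw [← hΨ]
    exact (b i).2

theorem choose_add_min_le_of_reduction [IsAlgClosed k] [CharZero k] {n c D B : ℕ} (hc : c ≠ 0)
    {V : Submodule k K} [FiniteDimensional k V] (hV : IsGradedSpan V)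
    (hVn : Module.finrank k V = n + c + 1)
    (hgen : IntermediateField.adjoin k (V : Set K) = ⊤) {w : Fin (n + 1) → K}
    (hwV : ∀ i, w i ∈ V) (hw : AlgebraicIndependent k w)
    (hB : V ^ (B + 1) ≤ Submodule.span k (Set.range w) * V ^ B) (e : Fin D → K)
    (he : ∀ p : Fin D → MvPolynomial (Fin (n + 1)) k,
      ∑ i, aeval w (p i) * e i = 0 → ∀ i, p i = 0) :
    (n + c + 2).choose 2 + min D (2 * c + 1) ≤
      (c + 2).choose 2 + Module.finrank k (V ^ 2 : Submodule k K) := by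
  obtain ⟨y, hy, hyV⟩ := exists_sup_span_eq (c := c) (r := n + 1) (by lia) hwV hw.linearIndependent
  let x : Option (Fin c) ⊕ Fin (n + 1) → K := Sum.elim (fun o => o.elim 1 y) w
  have hx : LinearIndependent k x := linearIndependent_sumElim_optionElim hy
    (by rw [hyV]; exact hV.one_notMem)
  have hyw : ∀ i, Sum.elim y w i ∈ V := fun i => by
    rw [← hyV]
    exact Submodule.subset_span ⟨i, rfl⟩
  have hV0 : V ≠ ⊥ := by
    rintro rfl
    simp at hVn
  have hz := isTranscendenceBasis_of_reduction hV0 hgen hw hB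
  have hgenx : IntermediateField.adjoin k (Set.range x) = ⊤ := by
    rw [eq_top_iff, ← hgen, IntermediateField.adjoin_le_iff, ← hyV]
    have : Submodule.span k (Set.range (Sum.elim y w)) ≤
        (IntermediateField.adjoin k (Set.range x)).toSubalgebra.toSubmodule := by
      rw [Submodule.span_le]
      rintro _ ⟨i | j, rfl⟩
      · exact IntermediateField.subset_adjoin k _ ⟨Sum.inl (some i), rfl⟩
      · exact IntermediateField.subset_adjoin k _ ⟨Sum.inr j, rfl⟩
    exact this
  have hxU : ∀ s, x s ∈ 1 ⊔ V := by
    rintro ((_ | i) | j)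
    · exact Submodule.mem_sup_left (Submodule.one_le.mp le_rfl)
    · exact Submodule.mem_sup_right (hyw (Sum.inl i))
    · exact Submodule.mem_sup_right (hyw (Sum.inr j))
  have hfin1 : FiniteDimensional k (1 : Submodule k K) := by
    rw [Submodule.one_eq_span]
    infer_instance
  have hfU : FiniteDimensional k ((1 ⊔ V) * (1 ⊔ V) : Submodule k K) :=
    Module.Finite.iff_fg.mpr ((Module.Finite.iff_fg.mp inferInstance).mul
      (Module.Finite.iff_fg.mp inferInstance))
  obtain ⟨N, Q, hN, hQ, hsymm, hrel⟩ := exists_symm_relations x hxU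
  have hne : Nonempty (Fin c) := ⟨⟨0, Nat.pos_of_ne_zero hc⟩⟩
  have h1 := card_add_min_le_choose hx rfl hz hgenx e he Q hQ hsymm hrel
  have h2 := finrank_sup_one_mul_sup_one_le (V := V)
  simp only [Fintype.card_fin, Fintype.card_sum, Fintype.card_option] at h1 hN
  have h3 : (c + 1 + (n + 1) + 1).choose 2 = (n + c + 2).choose 2 + (n + c + 2) := by
    rw [show c + 1 + (n + 1) + 1 = (n + c + 2) + 1 by lia, Nat.choose_succ_succ' _ 1,
      Nat.choose_one_right, add_comm]
  lia

end Graded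

section HomogeneousCoordinateRing

theorem homogeneousComponent_mem_vanIdeal {k : Type} [Field k] [Infinite k] {ι : Type} [Fintype ι]
    {C : Set (ι → k)} (hC : ∀ x ∈ C, ∀ t : k, t • x ∈ C) {f : MvPolynomial ι k}
    (hf : f ∈ vanIdeal k ι C) (m : ℕ) : homogeneousComponent m f ∈ vanIdeal k ι C := by
  simp only [vanIdeal, Submodule.mem_iInf, RingHom.mem_ker] at hf ⊢
  intro x hx
  let p : Polynomial k := ∑ i ∈ Finset.range (f.totalDegree + 1),
    Polynomial.monomial i (eval x (homogeneousComponent i f))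
  have hp : p = 0 := by
    refine Polynomial.funext fun t => ?_
    rw [Polynomial.eval_zero, ← hf _ (hC x hx t)]
    conv_rhs => rw [← sum_homogeneousComponent f]
    rw [map_sum, Polynomial.eval_finsetSum]
    refine Finset.sum_congr rfl fun i _ => ?_
    rw [eval_smul_of_isHomogeneous (homogeneousComponent_isHomogeneous i f),
      Polynomial.eval_monomial, mul_comm]
  by_cases hm : f.totalDegree < m
  · rw [homogeneousComponent_eq_zero _ _ hm, map_zero]
  · have h := congrArg (fun q => Polynomial.coeff q m) hp
    simpa [p, Polynomial.finsetSum_coeff, Polynomial.coeff_monomial,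
      Nat.lt_succ_iff.mpr (not_lt.mp hm)] using h

variable {k K : Type} [Field k] [Field K] [Algebra k K] {ι : Type} {u : ι → K}
  {I : Ideal (MvPolynomial ι k)}

theorem isGradedSpan_span_range (hI : ∀ f ∈ I, ∀ m, homogeneousComponent m f ∈ I)
    (hu : ∀ f, aeval u f = 0 ↔ f ∈ I) : IsGradedSpan (Submodule.span k (Set.range u)) := by
  intro B N v hv hsum m hm
  have h : ∀ m, ∃ f : MvPolynomial ι k, f.IsHomogeneous (B + m) ∧ aeval u f = v m := fun m => by
    have := hv m
    rw [← map_homogeneousSubmodule] at this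
    exact this
  choose f hf hfv using h
  have h1 : ∑ m ∈ Finset.range N, f m ∈ I := by
    rw [← hu, map_sum, ← hsum]
    exact Finset.sum_congr rfl fun i _ => hfv i
  have h2 := hI _ h1 (B + m)
  rw [map_sum, Finset.sum_eq_single m] at h2
  · rwa [homogeneousComponent_of_mem (hf m), if_pos rfl, ← hu, hfv] at h2
  · intro i _ him
    rw [homogeneousComponent_of_mem (hf i), if_neg (by lia)]
  · intro h
    exact absurd (Finset.mem_range.mpr hm) h

theorem finrank_idealPiece_add_finrank_pow [Fintype ι] [DecidableEq ι]
    (hu : ∀ f, aeval u f = 0 ↔ f ∈ I) (m : ℕ) :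
    Module.finrank k (idealPiece k ι I m) +
      Module.finrank k (Submodule.span k (Set.range u) ^ m : Submodule k K) =
        Module.finrank k (homogeneousSubmodule ι k m) := by
  have hfin := finite_homogeneousSubmodule (k := k) (β := ι) m
  let φ := (aeval (R := k) u).toLinearMap
  have h := LinearMap.finrank_range_add_finrank_ker (φ.domRestrict (homogeneousSubmodule ι k m))
  have hrange : LinearMap.range (φ.domRestrict (homogeneousSubmodule ι k m)) =
      Submodule.span k (Set.range u) ^ m := by
    rw [LinearMap.range_domRestrict, map_homogeneousSubmodule]
  have hker : (LinearMap.ker (φ.domRestrict (homogeneousSubmodule ι k m))).map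
      (homogeneousSubmodule ι k m).subtype = idealPiece k ι I m := by
    rw [LinearMap.ker_domRestrict, Submodule.map_comap_subtype, inf_comm]
    have : LinearMap.ker φ = I.restrictScalars k := by
      ext f
      exact hu f
    rw [this, idealPiece]
  rw [hrange, ← Submodule.finrank_map_subtype_eq, hker] at h
  rw [← h, add_comm]

theorem linearIndependent_of_linear_forms [Fintype ι] (hu : ∀ f, aeval u f = 0 ↔ f ∈ I)
    (hI : ∀ f ∈ homogeneousSubmodule ι k 1, f ∈ I → f = 0) : LinearIndependent k u := by
  classical
  rw [Fintype.linearIndependent_iff]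
  intro a ha i
  have h := hI (∑ i, a i • X i)
    (Submodule.sum_mem _ fun j _ => Submodule.smul_mem _ _ (isHomogeneous_X k j))
    ((hu _).mp (by simpa using ha))
  have h1 := congrArg (coeff (Finsupp.single i 1)) h
  simpa [coeff_sum, coeff_X, Finsupp.single_left_inj] using h1

theorem finrank_idealPiece_two_add_min_le [IsAlgClosed k] [CharZero k] {n c d : ℕ} (hc : c ≠ 0)
    (hd : d ≠ 0) {I : Ideal (MvPolynomial (Fin (n + c + 1)) k)}
    (hI : ∀ f ∈ I, ∀ m, homogeneousComponent m f ∈ I)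
    (hI1 : ∀ f ∈ homogeneousSubmodule (Fin (n + c + 1)) k 1, f ∈ I → f = 0)
    (hdeg : Filter.Tendsto (fun m : ℕ =>
      (idealHilb k (Fin (n + c + 1)) I m : ℝ) * (n.factorial : ℝ) / (m : ℝ) ^ n)
      Filter.atTop (nhds (d : ℝ)))
    {u : Fin (n + c + 1) → K} (hu : ∀ f, aeval u f = 0 ↔ f ∈ I)
    (hgen : IntermediateField.adjoin k (Set.range u) = ⊤) :
    Module.finrank k (idealPiece k (Fin (n + c + 1)) I 2) + min d (2 * c + 1) ≤
      (c + 2).choose 2 := by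
  let V := Submodule.span k (Set.range u)
  have hV : IsGradedSpan V := isGradedSpan_span_range hI hu
  have hVn : Module.finrank k V = n + c + 1 := by
    rw [finrank_span_eq_card (linearIndependent_of_linear_forms hu hI1), Fintype.card_fin]
  have hfV : FiniteDimensional k V := FiniteDimensional.span_of_finite k (Set.finite_range u)
  have hhilb : ∀ m, idealHilb k (Fin (n + c + 1)) I m =
      Module.finrank k (V ^ m : Submodule k K) := fun m => by
    rw [idealHilb, ← finrank_idealPiece_add_finrank_pow hu m, Nat.add_sub_cancel_left]
  have hgenV : IntermediateField.adjoin k (V : Set K) = ⊤ := by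
    rw [eq_top_iff, ← hgen]
    exact IntermediateField.adjoin.mono k _ _ Submodule.subset_span
  obtain ⟨r, w, B, hwV, hw, hB⟩ := exists_algebraicIndependent_reduction hV
  obtain ⟨D, e, T, he, hup⟩ := exists_finrank_pow_le hV hwV hw hB
  have hlow := multichoose_le_finrank_pow hwV hw
  rw [Fintype.card_fin] at hlow hup
  rcases r with _ | s
  · have h0 : V ^ (B + 1) = ⊥ := by simpa using hB
    have h1 := Submodule.pow_mem_pow V
      (Submodule.subset_span (Set.mem_range_self (f := u) 0)) (B + 1)
    rw [h0, Submodule.mem_bot] at h1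
    exact absurd (eq_zero_of_pow_eq_zero h1) ((linearIndependent_of_linear_forms hu hI1).ne_zero 0)
  · obtain ⟨rfl, hdD⟩ := eq_and_le_of_tendsto hd hdeg (fun m => by rw [hhilb]; exact hlow m)
      (B := B) (D := D) (T := T) (fun j => by rw [hhilb]; exact hup j)
    have h1 := choose_add_min_le_of_reduction hc hV hVn hgenV hwV hw hB e he
    have h2 := finrank_idealPiece_add_finrank_pow hu 2
    rw [finrank_homogeneousSubmodule, Fintype.card_fin, Nat.multichoose_eq] at h2
    change _ + Module.finrank k (V ^ 2 : Submodule k K) = (s + c + 2).choose 2 at h2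
    have h4 : min d (2 * c + 1) ≤ min D (2 * c + 1) := min_le_min_right _ hdD
    lia

theorem adjoin_range_eq_top_of_div (hu : ∀ x : K, ∃ f g : MvPolynomial ι k,
    aeval u f / aeval u g = x) : IntermediateField.adjoin k (Set.range u) = ⊤ := by
  rw [eq_top_iff]
  intro x _
  obtain ⟨f, g, rfl⟩ := hu x
  have h : ∀ f : MvPolynomial ι k, aeval u f ∈ IntermediateField.adjoin k (Set.range u) := fun f =>
    IntermediateField.algebra_adjoin_le_adjoin k _ (by
      rw [Algebra.adjoin_range_eq_range_aeval]
      exact ⟨f, rfl⟩)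
  exact div_mem (h f) (h g)

theorem exists_generic_point [I.IsPrime] :
    ∃ (L : Type) (_ : Field L) (_ : Algebra k L) (v : ι → L),
      (∀ f, aeval v f = 0 ↔ f ∈ I) ∧ IntermediateField.adjoin k (Set.range v) = ⊤ := by
  let L := FractionRing (MvPolynomial ι k ⧸ I)
  let φ : MvPolynomial ι k →ₐ[k] L :=
    (IsScalarTower.toAlgHom k (MvPolynomial ι k ⧸ I) L).comp (Ideal.Quotient.mkₐ k I)
  have hφ : aeval (fun i => φ (X i)) = φ := (aeval_unique φ).symm
  refine ⟨L, inferInstance, inferInstance, fun i => φ (X i), fun f => ?_,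
    adjoin_range_eq_top_of_div fun x => ?_⟩
  · rw [hφ, ← Ideal.Quotient.eq_zero_iff_mem]
    exact (map_eq_zero_iff (algebraMap (MvPolynomial ι k ⧸ I) L)
      (IsFractionRing.injective (MvPolynomial ι k ⧸ I) L))
  · obtain ⟨a, b, _, hab⟩ := IsFractionRing.div_surjective (A := MvPolynomial ι k ⧸ I) x
    obtain ⟨f, rfl⟩ := Ideal.Quotient.mk_surjective a
    obtain ⟨g, rfl⟩ := Ideal.Quotient.mk_surjective b
    rw [hφ]
    exact ⟨f, g, hab⟩

end HomogeneousCoordinateRing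

/-- Proposition 3.1.(1) = [Pa3, Cor. 4.3]. If a nondegenerate irreducible
projective variety `X ⊆ ℙ^{n+c}` of degree `d` satisfies `a₂(X) = C(c+1, 2) + 1 - K` with
`1 ≤ K ≤ c`, then `d ≤ c + K`. -/
theorem stmt_2 {k : Type} [Field k] [IsAlgClosed k] [CharZero k]
    (n c d K : ℕ) (hK1 : 1 ≤ K) (hKc : K ≤ c)
    (C : Set (Fin (n + c + 1) → k))
    (hV : IsProjVariety k (Fin (n + c + 1)) C)
    (hnd : Nondeg k (Fin (n + c + 1)) C)
    (hdim : HasDim k (Fin (n + c + 1)) C n)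
    (hdeg : HasDegree k (Fin (n + c + 1)) C n d)
    (ha : a2 k (Fin (n + c + 1)) C = Nat.choose (c + 1) 2 + 1 - K) :
    d ≤ c + K := by
  by_contra! h
  have hI1 : ∀ f ∈ homogeneousSubmodule (Fin (n + c + 1)) k 1,
      f ∈ vanIdeal k (Fin (n + c + 1)) C → f = 0 := fun f hf hfC => hnd f hf fun x hx => by
    simp only [vanIdeal, Submodule.mem_iInf, RingHom.mem_ker] at hfC
    exact hfC x hx
  have hprime := hV.prime
  obtain ⟨L, _, _, v, hv, hgen⟩ := exists_generic_point (I := vanIdeal k (Fin (n + c + 1)) C)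
  have h1 := finrank_idealPiece_two_add_min_le (d := d) (by lia) (by lia)
    (fun f hf m => homogeneousComponent_mem_vanIdeal hV.smul_mem hf m) hI1 hdeg hv hgen
  change a2 k (Fin (n + c + 1)) C + _ ≤ _ at h1
  have h2 : (c + 2).choose 2 = (c + 1).choose 2 + (c + 1) := by
    rw [Nat.choose_succ_succ' _ 1, Nat.choose_one_right, add_comm]
  have h3 : (c + 1).choose 2 = c.choose 2 + c := by
    rw [Nat.choose_succ_succ' _ 1, Nat.choose_one_right, add_comm]
  lia
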